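/- Let k ≥ 3 and 1 ≤ n₁ ≤ ⋯ ≤ n_k. The 5-secant variety of the Segre variety P^{n₁} × ⋯ × P^{n_k} is non-defective, i.e. T(n₁,…,n_k; 5; 0,…,0) holds, unless (n₁,…,n_k) = (2,3,3), (n₁,…,n_k) = (1,2,a) with a ≥ 5, (n₁,…,n_k) = (1,3,a) with a ≥ 5, or (n₁,…,n_k) = (1,1,2,2); in these exceptional cases T(n₁,…,n_k; 5; 0,…,0) fails. -/

import Mathlib

open scoped TensorProduct

/-- The subspace `G^i_p = v₁ ⊗ ⋯ ⊗ v_{i-1} ⊗ Vᵢ ⊗ v_{i+1} ⊗ ⋯ ⊗ v_k` of the tensor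
space `⨂ᵢ K^{nᵢ+1}` attached to the point `p = v₁ ⊗ ⋯ ⊗ v_k`. -/
noncomputable def segreG (K : Type*) [Field K] {k : ℕ} (n : Fin k → ℕ)
    (v : ∀ i, Fin (n i + 1) → K) (i : Fin k) :
    Submodule K (⨂[K] i, (Fin (n i + 1) → K)) :=
  LinearMap.range ((PiTensorProduct.tprod K).toLinearMap v i)

/-- The affine tangent space `T_p = Σᵢ v₁ ⊗ ⋯ ⊗ Vᵢ ⊗ ⋯ ⊗ v_k` to the Segre variety at
`p = v₁ ⊗ ⋯ ⊗ v_k`. -/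
noncomputable def segreTangent (K : Type*) [Field K] {k : ℕ} (n : Fin k → ℕ)
    (v : ∀ i, Fin (n i + 1) → K) : Submodule K (⨂[K] i, (Fin (n i + 1) → K)) :=
  ⨆ i, segreG K n v i

/-- The statement `T(n₁,…,n_k; s; a₁,…,a_k)` of Abo–Ottaviani–Peterson holds:
there are points `p₁,…,p_s` and `q_{i,1},…,q_{i,aᵢ}` (pure tensors of nonzero vectors)
such that the span of the tangent spaces `T_{p_j}` together with the subspaces
`G^i_{q_{i,l}}` has the expected (maximal possible) dimension
`min (s(1 + Σ nᵢ) + Σ aᵢ(nᵢ+1)) (Π (nᵢ+1))`. -/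
def THolds (K : Type*) [Field K] {k : ℕ} (n : Fin k → ℕ) (s : ℕ) (a : Fin k → ℕ) : Prop :=
  ∃ (p : Fin s → ∀ i, Fin (n i + 1) → K)
    (q : ∀ i : Fin k, Fin (a i) → ∀ j, Fin (n j + 1) → K),
    (∀ j i, p j i ≠ 0) ∧ (∀ i l j, q i l j ≠ 0) ∧
    Module.finrank K
      (((⨆ j, segreTangent K n (p j)) ⊔ (⨆ i, ⨆ l, segreG K n (q i l) i))
        : Submodule K (⨂[K] i, (Fin (n i + 1) → K)))
      = min (s * (1 + ∑ i, n i) + ∑ i, a i * (n i + 1)) (∏ i, (n i + 1))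

/-- The statement `T(n₁,…,n_k; s; a₁,…,a_k)` fails: every choice of points gives a span
of dimension strictly smaller than the expected dimension. -/
def TFails (K : Type*) [Field K] {k : ℕ} (n : Fin k → ℕ) (s : ℕ) (a : Fin k → ℕ) : Prop :=
  ∀ (p : Fin s → ∀ i, Fin (n i + 1) → K)
    (q : ∀ i : Fin k, Fin (a i) → ∀ j, Fin (n j + 1) → K),
    (∀ j i, p j i ≠ 0) → (∀ i l j, q i l j ≠ 0) →
    Module.finrank K
      (((⨆ j, segreTangent K n (p j)) ⊔ (⨆ i, ⨆ l, segreG K n (q i l) i))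
        : Submodule K (⨂[K] i, (Fin (n i + 1) → K)))
      < min (s * (1 + ∑ i, n i) + ∑ i, a i * (n i + 1)) (∏ i, (n i + 1))

/-- The tuple `(n; s; a)` is subabundant. -/
def Subabundant {k : ℕ} (n : Fin k → ℕ) (s : ℕ) (a : Fin k → ℕ) : Prop :=
  s * (1 + ∑ i, n i) + ∑ i, a i * (n i + 1) ≤ ∏ i, (n i + 1)

/-- The tuple `(n; s; a)` is superabundant. -/
def Superabundant {k : ℕ} (n : Fin k → ℕ) (s : ℕ) (a : Fin k → ℕ) : Prop :=
  ∏ i, (n i + 1) ≤ s * (1 + ∑ i, n i) + ∑ i, a i * (n i + 1)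

section Elimination

open scoped Matrix

/-- Clear the entry of `s` in column `c`, modulo `p`, by means of the row `r`. -/
def clearColumn (p c : ℕ) (r s : List ℕ) : List ℕ :=
  if s.getD c 0 % p = 0 then s
  else List.zipWith (fun a b => (r.getD c 0 * b + (p - s.getD c 0 % p) * a) % p) r s

/-- Gaussian elimination modulo `p`: tests whether the given rows are linearly independent,
using at most `m` elimination rounds. -/
def rowsIndependentMod (p : ℕ) : ℕ → List (List ℕ) → Bool
  | _, [] => true
  | 0, _ :: _ => false
  | m + 1, r :: rs =>
    r.getD (r.findIdx fun a => a % p != 0) 0 % p != 0 &&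
      rowsIndependentMod p m (rs.map (clearColumn p (r.findIdx fun a => a % p != 0) r))

theorem clearColumn_spec {p : ℕ} [Fact p.Prime] {N c : ℕ} {r s : List ℕ} (hr : r.length = N)
    (hs : s.length = N) (hc : ((r.getD c 0 : ℕ) : ZMod p) ≠ 0) :
    (clearColumn p c r s).length = N ∧ (((clearColumn p c r s).getD c 0 : ℕ) : ZMod p) = 0 ∧
      ∃ α β : ZMod p, ∀ d, ((s.getD d 0 : ℕ) : ZMod p) =
        α * ((clearColumn p c r s).getD d 0 : ℕ) + β * (r.getD d 0 : ℕ) ∧ α ≠ 0 := by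
  have hmod : ∀ a : ℕ, a % p = 0 ↔ ((a : ℕ) : ZMod p) = 0 := fun a => by
    rw [ZMod.natCast_eq_zero_iff, Nat.dvd_iff_mod_eq_zero]
  by_cases h : s.getD c 0 % p = 0
  · rw [clearColumn, if_pos h]
    exact ⟨hs, (hmod _).1 h, 1, 0, fun d => by simp⟩
  · rw [clearColumn, if_neg h]
    have hp : s.getD c 0 % p ≤ p := (Nat.mod_lt _ (Fact.out : p.Prime).pos).le
    have key : ∀ d, (((List.zipWith (fun a b => (r.getD c 0 * b + (p - s.getD c 0 % p) * a) % p)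
        r s).getD d 0 : ℕ) : ZMod p) = (r.getD c 0 : ℕ) * (s.getD d 0 : ℕ)
          - (s.getD c 0 : ℕ) * (r.getD d 0 : ℕ) := by
      intro d
      by_cases hd : d < N
      · have h1 : r[d]? = some (r[d]'(by omega)) := by simp [hr, hd]
        have h2 : s[d]? = some (s[d]'(by omega)) := by simp [hs, hd]
        rw [List.getD_eq_getElem?_getD, List.getElem?_zipWith, h1, h2]
        simp only [Option.getD_some, List.getD_eq_getElem?_getD (i := d), h1, h2]
        simp only [ZMod.natCast_mod, Nat.cast_add, Nat.cast_mul, Nat.cast_sub hp, CharP.cast_eq_zero]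
        ring
      · simp [List.getD_eq_getElem?_getD, List.getElem?_eq_none (by omega : r.length ≤ d),
          List.getElem?_eq_none (by omega : s.length ≤ d), List.getElem?_zipWith]
    refine ⟨by simp [hr, hs], by rw [key]; ring, ((r.getD c 0 : ℕ) : ZMod p)⁻¹,
      ((r.getD c 0 : ℕ) : ZMod p)⁻¹ * (s.getD c 0 : ℕ), fun d => ⟨?_, inv_ne_zero hc⟩⟩
    rw [key]
    field_simp
    ring

theorem eq_zero_of_rowsIndependentMod {p : ℕ} [Fact p.Prime] {N : ℕ} (m : ℕ)
    (rows : List (List ℕ)) (hN : ∀ r ∈ rows, r.length = N)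
    (h : rowsIndependentMod p m rows = true) (μ : ℕ → ZMod p)
    (hμ : ∀ d, ∑ i ∈ Finset.range rows.length, μ i * ((rows.getD i []).getD d 0 : ℕ) = 0) :
    ∀ i < rows.length, μ i = 0 := by
  induction m generalizing rows μ with
  | zero => cases rows with
    | nil => simp
    | cons r rs => simp [rowsIndependentMod] at h
  | succ m ih => cases rows with
    | nil => simp
    | cons r rs =>
      rw [rowsIndependentMod] at h
      set c := r.findIdx fun a => a % p != 0
      simp only [Bool.and_eq_true, bne_iff_ne, ne_eq] at h
      have hc : ((r.getD c 0 : ℕ) : ZMod p) ≠ 0 := by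
        rw [Ne, ZMod.natCast_eq_zero_iff, Nat.dvd_iff_mod_eq_zero]
        exact h.1
      have hspec := fun i (hi : i < rs.length) =>
        clearColumn_spec (hN r (by simp)) (hN (rs[i]) (by simp)) hc
      have hspec' : ∀ i, ∃ α β : ZMod p, i < rs.length → α ≠ 0 ∧
          ∀ d, (((rs.getD i []).getD d 0 : ℕ) : ZMod p) =
            α * ((((rs.map (clearColumn p c r)).getD i []).getD d 0 : ℕ)) + β * (r.getD d 0 : ℕ) := by
        intro i
        by_cases hi : i < rs.length
        · obtain ⟨-, -, α, β, hd⟩ := hspec i hi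
          refine ⟨α, β, fun _ => ⟨(hd 0).2, fun d => ?_⟩⟩
          simpa [List.getD_eq_getElem?_getD, hi] using (hd d).1
        · exact ⟨0, 0, fun h => absurd h hi⟩
      choose α β hαβ using hspec'
      have hpivot : ∀ i < rs.length,
          (((((rs.map (clearColumn p c r)).getD i []).getD c 0 : ℕ)) : ZMod p) = 0 := by
        intro i hi
        simpa [List.getD_eq_getElem?_getD, hi] using (hspec i hi).2.1
      have hsum : ∀ d, ∑ i ∈ Finset.range rs.length, μ (i + 1) * α i *
          ((((rs.map (clearColumn p c r)).getD i []).getD d 0 : ℕ)) +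
          (μ 0 + ∑ i ∈ Finset.range rs.length, μ (i + 1) * β i) * (r.getD d 0 : ℕ) = 0 := by
        intro d
        have := hμ d
        rw [List.length_cons, Finset.sum_range_succ'] at this
        simp only [List.getD_cons_succ, List.getD_cons_zero] at this
        rw [Finset.sum_congr rfl fun i hi => by
          rw [(hαβ i (Finset.mem_range.1 hi)).2 d, mul_add, ← mul_assoc, ← mul_assoc],
          Finset.sum_add_distrib, ← Finset.sum_mul] at this
        linear_combination this
      have hcoef : μ 0 + ∑ i ∈ Finset.range rs.length, μ (i + 1) * β i = 0 := by
        have := hsum c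
        rw [Finset.sum_eq_zero fun i hi => by rw [hpivot i (Finset.mem_range.1 hi), mul_zero],
          zero_add] at this
        exact (mul_eq_zero.1 this).resolve_right hc
      have htail : ∀ i < rs.length, μ (i + 1) = 0 := by
        intro i hi
        have := ih (rs.map (clearColumn p c r)) (by
            intro s hs
            obtain ⟨t, ht, rfl⟩ := List.mem_map.1 hs
            exact (clearColumn_spec (hN r (by simp)) (hN t (by simp [ht])) hc).1) h.2
          (fun i => μ (i + 1) * α i) (fun d => by
            have := hsum d
            rw [hcoef, zero_mul, add_zero] at this
            rw [List.length_map]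
            exact this) i (by simpa using hi)
        exact (mul_eq_zero.1 this).resolve_right (hαβ i hi).1
      have hhead : μ 0 = 0 := by
        rwa [Finset.sum_eq_zero fun i hi => by rw [htail i (Finset.mem_range.1 hi), zero_mul],
          add_zero] at hcoef
      intro i hi
      cases i with
      | zero => exact hhead
      | succ i => exact htail i (by simpa using hi)

theorem Matrix.exists_mul_eq_one_of_linearIndependent_row {F m n : Type*} [Field F] [Fintype m]
    [Fintype n] [DecidableEq m] {A : Matrix m n F} (h : LinearIndependent F A.row) :
    ∃ B : Matrix n m F, A * B = 1 := by
  classical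
  have hinj : LinearMap.ker A.vecMulLinear = ⊥ :=
    LinearMap.ker_eq_bot.2 (Matrix.vecMul_injective_iff.2 h)
  obtain ⟨g, hg⟩ := A.vecMulLinear.exists_leftInverse_of_injective hinj
  refine ⟨(LinearMap.toMatrix' g)ᵀ, Matrix.ext_of_single_vecMul fun i => ?_⟩
  have h1 : ∀ v, v ᵥ* (LinearMap.toMatrix' g)ᵀ = g v := fun v => by
    rw [Matrix.vecMul_transpose, LinearMap.toMatrix'_mulVec]
  rw [← Matrix.vecMul_vecMul, h1, Matrix.vecMul_one]
  exact LinearMap.congr_fun hg (Pi.single i 1)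

theorem Matrix.linearIndependent_row_of_det_mul_ne_zero {F m n : Type*} [Field F] [Fintype m]
    [Fintype n] [DecidableEq m] {A : Matrix m n F} (B : Matrix n m F) (h : (A * B).det ≠ 0) :
    LinearIndependent F A.row := by
  rw [← Matrix.vecMul_injective_iff]
  refine (injective_iff_map_eq_zero A.vecMulLinear).2 fun v hv => ?_
  refine Matrix.eq_zero_of_vecMul_eq_zero h ?_
  rw [← Matrix.vecMul_vecMul]
  change A.vecMulLinear v ᵥ* B = 0
  rw [hv, Matrix.zero_vecMul]

theorem Matrix.det_map_natCast_mul (R : Type*) [CommRing R] {m n : Type*} [Fintype m]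
    [DecidableEq m] [Fintype n] (A : Matrix m n ℕ) (C : Matrix n m ℕ) :
    (A.map ((↑) : ℕ → R) * C.map ((↑) : ℕ → R)).det =
      (((A * C).map ((↑) : ℕ → ℤ)).det : R) := by
  have h : A.map ((↑) : ℕ → R) * C.map ((↑) : ℕ → R) =
      (Int.castRingHom R).mapMatrix ((A * C).map ((↑) : ℕ → ℤ)) := by
    ext
    simp [Matrix.mul_apply]
  rw [h, ← RingHom.map_det]
  rfl

theorem linearIndependent_natCast_of_zmod (K : Type*) [Field K] [CharZero K] {p : ℕ}
    [Fact p.Prime] {m n : Type*} [Fintype m] [Fintype n] (A : Matrix m n ℕ)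
    (h : LinearIndependent (ZMod p) (A.map ((↑) : ℕ → ZMod p)).row) :
    LinearIndependent K (A.map ((↑) : ℕ → K)).row := by
  classical
  obtain ⟨B, hB⟩ := Matrix.exists_mul_eq_one_of_linearIndependent_row h
  let C : Matrix n m ℕ := B.map fun x => x.val
  have hC : C.map ((↑) : ℕ → ZMod p) = B := by
    ext
    simp [C]
  refine Matrix.linearIndependent_row_of_det_mul_ne_zero (C.map ((↑) : ℕ → K)) ?_
  rw [Matrix.det_map_natCast_mul, Int.cast_ne_zero]
  intro h0
  have h1 := Matrix.det_map_natCast_mul (ZMod p) A C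
  rw [hC, hB, h0, Matrix.det_one, Int.cast_zero] at h1
  exact one_ne_zero h1

end Elimination

section TangentRows

open Finset

/-- The tangent spaces at the `s` points with coordinates `v j l h` (point `j`, factor `l < k`,
coordinate `h ≤ n l`) are linearly independent and of the expected dimension. In each tangent
space the directions are normalized to have zeroth coordinate zero. -/
def TangentIndep (K : Type*) [Field K] (s k : ℕ) (n : ℕ → ℕ) (v : ℕ → ℕ → ℕ → K) : Prop :=
  ∀ (c : ℕ → K) (x : ℕ → ℕ → ℕ → K), (∀ j i, x j i 0 = 0) →
    (∀ I : ℕ → ℕ, (∀ l < k, I l ≤ n l) →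
      ∑ j ∈ range s, (c j * ∏ l ∈ range k, v j l (I l) +
        ∑ i ∈ range k, x j i (I i) * ∏ l ∈ (range k).erase i, v j l (I l)) = 0) →
    ∀ j < s, c j = 0 ∧ ∀ i < k, ∀ h ≤ n i, x j i h = 0

/-- The coordinate with multi-index `I` of the tangent vector `r = (j, i, h)`: the `j`-th point,
with its `i`-th factor replaced by the `h`-th basis vector if `i < k`. -/
def tangentEntry (v : ℕ → ℕ → ℕ → ℕ) : ℕ → ℕ × ℕ × ℕ → (ℕ → ℕ) → ℕ
  | 0, _, _ => 1
  | k + 1, r, I => tangentEntry v k r I *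
      if r.2.1 = k then (if I k = r.2.2 then 1 else 0) else v r.1 k (I k)

/-- The labels of the tangent vectors spanning the tangent spaces at `s` points. -/
def tangentRows (s k : ℕ) (n : ℕ → ℕ) : List (ℕ × ℕ × ℕ) :=
  (List.range s).flatMap fun j => (j, k, 0) :: (List.range k).flatMap fun i =>
    (List.range (n i)).map fun h => (j, i, h + 1)

/-- The multi-index with number `m` in the mixed radix system with digits bounded by `n`. -/
def multiIndex (n : ℕ → ℕ) (m l : ℕ) : ℕ :=
  m / ((List.range l).map fun i => n i + 1).prod % (n l + 1)

/-- Tests modulo `p` whether tangent spaces at integral points are independent. -/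
def tangentCheck (p s k : ℕ) (n : ℕ → ℕ) (v : ℕ → ℕ → ℕ → ℕ) : Bool :=
  rowsIndependentMod p (tangentRows s k n).length ((tangentRows s k n).map fun r =>
    (List.range ((List.range k).map fun i => n i + 1).prod).map fun m =>
      tangentEntry v k r (multiIndex n m))

theorem tangentEntry_eq_prod (v : ℕ → ℕ → ℕ → ℕ) (k : ℕ) (r : ℕ × ℕ × ℕ) (I : ℕ → ℕ) :
    tangentEntry v k r I = ∏ l ∈ range k,
      if r.2.1 = l then (if I l = r.2.2 then 1 else 0) else v r.1 l (I l) := by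
  induction k with
  | zero => rfl
  | succ k ih => rw [tangentEntry, ih, prod_range_succ]

theorem tangentEntry_point (v : ℕ → ℕ → ℕ → ℕ) (k j h : ℕ) (I : ℕ → ℕ) :
    tangentEntry v k (j, k, h) I = ∏ l ∈ range k, v j l (I l) := by
  rw [tangentEntry_eq_prod]
  exact prod_congr rfl fun l hl => if_neg (mem_range.1 hl).ne'

theorem tangentEntry_direction (v : ℕ → ℕ → ℕ → ℕ) {k i : ℕ} (hi : i < k) (j h : ℕ) (I : ℕ → ℕ) :
    tangentEntry v k (j, i, h) I =
      (if I i = h then 1 else 0) * ∏ l ∈ (range k).erase i, v j l (I l) := by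
  rw [tangentEntry_eq_prod, ← mul_prod_erase _ _ (mem_range.2 hi), if_pos rfl]
  congr 1
  exact prod_congr rfl fun l hl => if_neg (ne_of_mem_erase hl).symm

theorem sum_map_tangentRows {M : Type*} [AddCommMonoid M] (s k : ℕ) (n : ℕ → ℕ)
    (f : ℕ × ℕ × ℕ → M) :
    ((tangentRows s k n).map f).sum = ∑ j ∈ range s, (f (j, k, 0) +
      ∑ i ∈ range k, ∑ h ∈ range (n i), f (j, i, h + 1)) := by
  have hrange : ∀ (m : ℕ) (g : ℕ → M), ((List.range m).map g).sum = ∑ i ∈ range m, g i :=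
    fun m g => rfl
  have hflat : ∀ (m : ℕ) (g : ℕ → List (ℕ × ℕ × ℕ)),
      (((List.range m).flatMap g).map f).sum = ∑ i ∈ range m, ((g i).map f).sum := by
    intro m g
    rw [← hrange, List.map_flatMap, List.flatMap, List.sum_flatten, List.map_map]
    rfl
  rw [tangentRows, hflat]
  simp only [List.map_cons, List.sum_cons, hflat, List.map_map, hrange, Function.comp_apply]

theorem tangentIndep_of_tangentCheck (K : Type*) [Field K] [CharZero K] (p : ℕ) [Fact p.Prime]
    {s k : ℕ} {n : ℕ → ℕ} {v : ℕ → ℕ → ℕ → ℕ} (h : tangentCheck p s k n v = true) :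
    TangentIndep K s k n fun j l h => (v j l h : K) := by
  intro c x hx hsum
  unfold tangentCheck at h
  generalize hR : tangentRows s k n = R at h
  generalize ((List.range k).map fun i => n i + 1).prod = N at h
  let A : Matrix (Fin R.length) (Fin N) ℕ := fun i m => tangentEntry v k R[i.1] (multiIndex n m)
  have hcell : ∀ i : Fin R.length, ∀ d, ((R.map fun r => (List.range N).map fun m =>
      tangentEntry v k r (multiIndex n m)).getD i []).getD d 0 =
      if hd : d < N then A i ⟨d, hd⟩ else 0 := by
    intro i d
    rw [List.getD_eq_getElem?_getD (l := R.map _), List.getElem?_map, List.getElem?_eq_getElem i.2,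
      Option.map_some, Option.getD_some, List.getD_eq_getElem?_getD, List.getElem?_map]
    split_ifs with hd
    · rw [List.getElem?_range hd]
      rfl
    · rw [List.getElem?_eq_none (by simpa using hd)]
      rfl
  have hA : LinearIndependent (ZMod p) (A.map ((↑) : ℕ → ZMod p)).row := by
    rw [Fintype.linearIndependent_iff]
    intro g hg i
    have := eq_zero_of_rowsIndependentMod (p := p) (N := N) _ _ (by
        intro r hr
        obtain ⟨_, _, rfl⟩ := List.mem_map.1 hr
        simp) h
      (fun i => if hi : i < R.length then g ⟨i, hi⟩ else 0) (fun d => by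
        rw [List.length_map, Finset.sum_range]
        simp only [hcell, Fin.is_lt, dite_true]
        by_cases hd : d < N
        · rw [← show _ = (0 : ZMod p) from congrFun hg ⟨d, hd⟩, Finset.sum_apply]
          refine Finset.sum_congr rfl fun i _ => ?_
          rw [dif_pos hd]
          rfl
        · simp [hd]) i (by simp)
    simpa using this
  have hK := linearIndependent_natCast_of_zmod K A hA
  rw [Fintype.linearIndependent_iff] at hK
  let coef : ℕ × ℕ × ℕ → K := fun r => if r.2.1 = k then c r.1 else x r.1 r.2.1 r.2.2
  have hcoef : ∀ r ∈ R, coef r = 0 := by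
    have := hK (fun i => coef R[i.1]) (by
      ext m
      rw [Finset.sum_apply]
      change ∑ i : Fin R.length, coef R[i.1] * (tangentEntry v k R[i.1] (multiIndex n m) : K) = 0
      rw [Fin.sum_univ_fun_getElem R fun r => coef r * (tangentEntry v k r (multiIndex n m) : K),
        ← hR, sum_map_tangentRows]
      have hI : ∀ l < k, multiIndex n m l ≤ n l := fun l _ =>
        Nat.lt_succ_iff.1 (Nat.mod_lt _ (Nat.succ_pos _))
      rw [← hsum (multiIndex n m) hI]
      refine sum_congr rfl fun j _ => ?_
      congr 1
      · simp [coef, tangentEntry_point]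
      · refine sum_congr rfl fun i hi => ?_
        have hik := mem_range.1 hi
        simp only [coef, tangentEntry_direction v hik, if_neg hik.ne]
        push_cast
        simp only [← mul_assoc]
        rw [← sum_mul]
        congr 1
        have hle := hI i hik
        generalize multiIndex n m i = a at hle
        cases a with
        | zero => simp [hx]
        | succ a =>
          rw [sum_eq_single a] <;> simp
          · intro b _ hb hab
            exact absurd hab.symm hb
          · omega)
    intro r hr
    obtain ⟨i, hi, rfl⟩ := List.getElem_of_mem hr
    exact this ⟨i, hi⟩
  intro j hj
  refine ⟨?_, fun i hi h hh => ?_⟩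
  · have := hcoef (j, k, 0) (by simp [← hR, tangentRows, hj])
    simpa [coef] using this
  · cases h with
    | zero => exact hx j i
    | succ h =>
      have := hcoef (j, i, h + 1) (by
        simp only [← hR, tangentRows, List.mem_flatMap, List.mem_range, List.mem_cons]
        exact ⟨j, hj, Or.inr ⟨i, hi, by simpa using hh⟩⟩)
      simpa [coef, hi.ne] using this

end TangentRows

section BasePoints

set_option maxRecDepth 100000

/-- The coordinate function given by a table of points, factors and coordinates. -/
def pointTable (t : List (List (List ℕ))) (j l h : ℕ) : ℕ :=
  ((t.getD j []).getD l []).getD h 0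

/-- The function `ℕ → ℕ` listed by `t`, extended by zero. -/
def tuple (t : List ℕ) (l : ℕ) : ℕ :=
  t.getD l 0

theorem exists_tangentIndep_of_table (K : Type*) [Field K] [CharZero K] {k : ℕ} {n : ℕ → ℕ}
    (t : List (List (List ℕ))) (h : tangentCheck 5 5 k n (pointTable t) = true)
    (h0 : ∀ j < 5, ∀ l < k, pointTable t j l 0 = 1) :
    ∃ v : ℕ → ℕ → ℕ → K, (∀ j < 5, ∀ l < k, v j l 0 = 1) ∧ TangentIndep K 5 k n v := by
  have : Fact (Nat.Prime 5) := ⟨Nat.prime_five⟩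
  exact ⟨_, fun j hj l hl => by rw [h0 j hj l hl, Nat.cast_one],
    tangentIndep_of_tangentCheck K 5 h⟩

variable (K : Type*) [Field K] [CharZero K]

theorem exists_tangentIndep_one_four_four :
    ∃ v : ℕ → ℕ → ℕ → K, (∀ j < 5, ∀ l < 3, v j l 0 = 1) ∧
      TangentIndep K 5 3 (tuple [1, 4, 4]) v :=
  exists_tangentIndep_of_table K
    [[[1, 0], [1, 0, 0, 0, 0], [1, 0, 0, 0, 0]],
     [[1, 4], [1, 1, 0, 0, 0], [1, 1, 0, 0, 0]],
     [[1, 3], [1, 0, 1, 0, 0], [1, 0, 1, 0, 0]],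
     [[1, 2], [1, 0, 0, 1, 0], [1, 0, 0, 1, 0]],
     [[1, 1], [1, 0, 0, 0, 1], [1, 0, 0, 0, 1]]]
    (by decide +kernel) (by decide)

theorem exists_tangentIndep_two_two_four :
    ∃ v : ℕ → ℕ → ℕ → K, (∀ j < 5, ∀ l < 3, v j l 0 = 1) ∧
      TangentIndep K 5 3 (tuple [2, 2, 4]) v :=
  exists_tangentIndep_of_table K
    [[[1, 2, 0], [1, 1, 1], [1, 0, 0, 0, 0]],
     [[1, 0, 0], [1, 0, 0], [1, 1, 0, 0, 0]],
     [[1, 1, 1], [1, 0, 1], [1, 0, 1, 0, 0]],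
     [[1, 0, 1], [1, 3, 0], [1, 0, 0, 1, 0]],
     [[1, 1, 0], [1, 1, 0], [1, 0, 0, 0, 1]]]
    (by decide +kernel) (by decide)

theorem exists_tangentIndep_three_three_three :
    ∃ v : ℕ → ℕ → ℕ → K, (∀ j < 5, ∀ l < 3, v j l 0 = 1) ∧
      TangentIndep K 5 3 (tuple [3, 3, 3]) v :=
  exists_tangentIndep_of_table K
    [[[1, 0, 0, 0], [1, 0, 0, 0], [1, 0, 0, 0]],
     [[1, 1, 0, 0], [1, 1, 0, 0], [1, 1, 0, 0]],
     [[1, 0, 1, 0], [1, 0, 1, 0], [1, 0, 1, 0]],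
     [[1, 0, 0, 1], [1, 0, 0, 1], [1, 0, 0, 1]],
     [[1, 1, 1, 0], [1, 1, 1, 0], [1, 1, 0, 1]]]
    (by decide +kernel) (by decide)

theorem exists_tangentIndep_one_one_one_four :
    ∃ v : ℕ → ℕ → ℕ → K, (∀ j < 5, ∀ l < 4, v j l 0 = 1) ∧
      TangentIndep K 5 4 (tuple [1, 1, 1, 4]) v :=
  exists_tangentIndep_of_table K
    [[[1, 0], [1, 2], [1, 0], [1, 0, 0, 0, 0]],
     [[1, 1], [1, 2], [1, 2], [1, 1, 0, 0, 0]],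
     [[1, 1], [1, 0], [1, 1], [1, 0, 1, 0, 0]],
     [[1, 0], [1, 1], [1, 1], [1, 0, 0, 1, 0]],
     [[1, 2], [1, 0], [1, 0], [1, 0, 0, 0, 1]]]
    (by decide +kernel) (by decide)

theorem exists_tangentIndep_one_one_two_three :
    ∃ v : ℕ → ℕ → ℕ → K, (∀ j < 5, ∀ l < 4, v j l 0 = 1) ∧
      TangentIndep K 5 4 (tuple [1, 1, 2, 3]) v :=
  exists_tangentIndep_of_table K
    [[[1, 0], [1, 2], [1, 0, 1], [1, 0, 0, 0]],
     [[1, 0], [1, 0], [1, 0, 0], [1, 1, 0, 0]],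
     [[1, 0], [1, 1], [1, 1, 0], [1, 0, 1, 0]],
     [[1, 1], [1, 1], [1, 0, 0], [1, 0, 0, 1]],
     [[1, 1], [1, 0], [1, 1, 0], [1, 0, 1, 1]]]
    (by decide +kernel) (by decide)

theorem exists_tangentIndep_one_two_two_two :
    ∃ v : ℕ → ℕ → ℕ → K, (∀ j < 5, ∀ l < 4, v j l 0 = 1) ∧
      TangentIndep K 5 4 (tuple [1, 2, 2, 2]) v :=
  exists_tangentIndep_of_table K
    [[[1, 1], [1, 1, 0], [1, 0, 0], [1, 0, 0]],
     [[1, 0], [1, 0, 0], [1, 1, 0], [1, 0, 0]],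
     [[1, 0], [1, 1, 0], [1, 0, 1], [1, 0, 1]],
     [[1, 1], [1, 0, 0], [1, 0, 1], [1, 1, 0]],
     [[1, 0], [1, 0, 1], [1, 0, 0], [1, 1, 0]]]
    (by decide +kernel) (by decide)

theorem exists_tangentIndep_one_one_one_one_one :
    ∃ v : ℕ → ℕ → ℕ → K, (∀ j < 5, ∀ l < 5, v j l 0 = 1) ∧
      TangentIndep K 5 5 (tuple [1, 1, 1, 1, 1]) v :=
  exists_tangentIndep_of_table K
    [[[1, 0], [1, 1], [1, 2], [1, 0], [1, 1]],
     [[1, 1], [1, 0], [1, 1], [1, 0], [1, 0]],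
     [[1, 0], [1, 2], [1, 1], [1, 2], [1, 0]],
     [[1, 2], [1, 0], [1, 0], [1, 1], [1, 2]],
     [[1, 1], [1, 1], [1, 0], [1, 1], [1, 1]]]
    (by decide +kernel) (by decide)

end BasePoints

section Extension

open Finset

/-- Extend the coordinates of points in `k₀` factors, bounded by `n₀`, to more factors and
more coordinates, with new coordinates `(1, 0, …, 0)` respectively zero. -/
def extendCoord {K : Type*} [Zero K] [One K] (k₀ : ℕ) (n₀ : ℕ → ℕ) (v : ℕ → ℕ → ℕ → K)
    (j l h : ℕ) : K :=
  if l < k₀ then (if h ≤ n₀ l then v j l h else 0) else (if h = 0 then 1 else 0)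

theorem extendCoord_zero {K : Type*} [Zero K] [One K] {s k₀ : ℕ} {n₀ : ℕ → ℕ} {v : ℕ → ℕ → ℕ → K}
    (h : ∀ j < s, ∀ l < k₀, v j l 0 = 1) {j : ℕ} (hj : j < s) (l : ℕ) :
    extendCoord k₀ n₀ v j l 0 = 1 := by
  rw [extendCoord]
  split_ifs with h1 h2 h2
  · exact h j hj l h1
  · exact absurd (Nat.zero_le _) h2
  · rfl
  · exact absurd rfl h2

variable {K : Type*} [Field K]

theorem prod_extendCoord_erase {k₀ k i j : ℕ} {n₀ : ℕ → ℕ} {v : ℕ → ℕ → ℕ → K} (hk : k₀ ≤ k)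
    {I I' : ℕ → ℕ} (hI : ∀ l < k₀, I l ≤ n₀ l) (h1 : ∀ l < k₀, l ≠ i → I' l = I l)
    (h2 : ∀ l, k₀ ≤ l → l ≠ i → I' l = 0) :
    ∏ l ∈ (range k).erase i, extendCoord k₀ n₀ v j l (I' l) =
      ∏ l ∈ (range k₀).erase i, v j l (I l) := by
  have hsub : (range k₀).erase i ⊆ (range k).erase i := erase_subset_erase _ (range_mono hk)
  rw [← prod_subset hsub fun l hl hl' => ?_]
  · refine prod_congr rfl fun l hl => ?_
    have hl1 := mem_range.1 (mem_of_mem_erase hl)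
    rw [extendCoord, if_pos hl1, h1 l hl1 (ne_of_mem_erase hl), if_pos (hI l hl1)]
  · have hl1 : k₀ ≤ l := by
      by_contra hlt
      exact hl' (mem_erase.2 ⟨ne_of_mem_erase hl, mem_range.2 (not_le.1 hlt)⟩)
    rw [extendCoord, if_neg hl1.not_gt, h2 l hl1 (ne_of_mem_erase hl), if_pos rfl]

theorem TangentIndep.extend {s k₀ k : ℕ} {n₀ n : ℕ → ℕ} {v : ℕ → ℕ → ℕ → K}
    (H : TangentIndep K s k₀ n₀ v) (hk : k₀ ≤ k) (hn : ∀ a < k₀, 1 ≤ n₀ a ∧ n₀ a ≤ n a) :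
    TangentIndep K s k n (extendCoord k₀ n₀ v) := by
  intro c x hx hsum
  have hlow : ∀ j < s, c j = 0 ∧ ∀ i < k₀, ∀ h ≤ n₀ i, x j i h = 0 := by
    refine H c x hx fun I hI => ?_
    have := hsum (fun l => if l < k₀ then I l else 0) (fun l _ => by
      split_ifs with hl
      · exact (hI l hl).trans (hn l hl).2
      · exact Nat.zero_le _)
    rw [← this]
    refine sum_congr rfl fun j _ => ?_
    congr 1
    · congr 1
      have := prod_extendCoord_erase (i := k) (j := j) (v := v) hk hI
        (I' := fun l => if l < k₀ then I l else 0) (fun l hl _ => if_pos hl)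
        (fun l hl _ => if_neg hl.not_gt)
      rw [erase_eq_of_notMem (by simp), erase_eq_of_notMem (by simpa using hk)] at this
      exact this.symm
    · rw [← sum_subset (range_mono hk)]
      · refine sum_congr rfl fun i hi => ?_
        rw [if_pos (mem_range.1 hi)]
        congr 1
        exact (prod_extendCoord_erase hk hI (fun l hl _ => if_pos hl)
          (fun l hl _ => if_neg hl.not_gt)).symm
      · intro i _ hi
        rw [if_neg (by simpa using hi), hx, zero_mul]
  have hhigh : ∀ i < k, ∀ h ≤ n i, (i < k₀ → n₀ i < h) → h ≠ 0 → ∀ I : ℕ → ℕ,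
      (∀ l < k₀, I l ≤ n₀ l) →
      ∑ j ∈ range s, x j i h * ∏ l ∈ (range k₀).erase i, v j l (I l) = 0 := by
    intro i hi h hh hih hh0 I hI
    have := hsum (Function.update (fun l => if l < k₀ then I l else 0) i h) (fun l _ => by
      by_cases hli : l = i
      · subst hli
        simpa using hh
      · rw [Function.update_of_ne hli]
        split_ifs with hl
        · exact (hI l hl).trans (hn l hl).2
        · exact Nat.zero_le _)
    rw [← this]
    refine sum_congr rfl fun j hj => ?_
    rw [(hlow j (mem_range.1 hj)).1, zero_mul, zero_add, sum_eq_single i]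
    · rw [Function.update_self]
      congr 1
      refine (prod_extendCoord_erase hk hI (fun l hl hli => ?_) (fun l hl hli => ?_)).symm
      · rw [Function.update_of_ne hli, if_pos hl]
      · rw [Function.update_of_ne hli, if_neg hl.not_gt]
    · intro b hb hbi
      rw [prod_eq_zero (i := i) (mem_erase.2 ⟨hbi.symm, mem_range.2 hi⟩), mul_zero]
      rw [Function.update_self, extendCoord]
      split_ifs with h1 h2
      · exact absurd h2 (hih h1).not_ge
      · rfl
      · rfl
    · intro hi'
      exact absurd (mem_range.2 hi) hi'
  intro j hj
  refine ⟨(hlow j hj).1, fun i hi h hh => ?_⟩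
  rcases eq_or_ne h 0 with rfl | hh0
  · exact hx j i
  rcases lt_or_ge i k₀ with hik | hik
  · rcases le_or_gt h (n₀ i) with hle | hlt
    · exact (hlow j hj).2 i hik h hle
    · have := H 0 (fun j i' h' => if i' = i ∧ h' = 1 then x j i h else 0) (by simp) (fun I hI => by
        by_cases hI1 : I i = 1
        · refine Eq.trans ?_ (hhigh i hi h hh (fun _ => hlt) hh0 I hI)
          refine sum_congr rfl fun j _ => ?_
          rw [Pi.zero_apply, zero_mul, zero_add, sum_eq_single i]
          · rw [if_pos ⟨rfl, hI1⟩]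
          · intro b _ hb
            rw [if_neg fun h => hb h.1, zero_mul]
          · intro hi'
            exact absurd (mem_range.2 hik) hi'
        · refine sum_eq_zero fun j _ => ?_
          rw [Pi.zero_apply, zero_mul, zero_add]
          refine sum_eq_zero fun b _ => ?_
          rw [if_neg, zero_mul]
          rintro ⟨rfl, h1⟩
          exact hI1 h1) j hj
      simpa using this.2 i hik 1 (hn i hik).1
  · have := H (fun j => x j i h) 0 (by simp) (fun I hI => by
      have := hhigh i hi h hh (fun h => absurd h hik.not_gt) hh0 I hI
      rw [erase_eq_of_notMem (by simpa using hik)] at this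
      simpa using this) j hj
    exact this.1

end Extension

section TangentParametrization

open Finset PiTensorProduct

/-- The span of the tangent spaces to the Segre variety at the points `p j`. -/
noncomputable def tangentSpan (K : Type*) [Field K] {k s : ℕ} (n : Fin k → ℕ)
    (p : Fin s → ∀ i, Fin (n i + 1) → K) : Submodule K (⨂[K] i, (Fin (n i + 1) → K)) :=
  ⨆ j, segreTangent K n (p j)

/-- The inclusion of the vectors with zeroth coordinate zero. -/
def consZero (K : Type*) [Field K] (m : ℕ) : (Fin m → K) →ₗ[K] (Fin (m + 1) → K) where
  toFun x := Fin.cons 0 x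
  map_add' x y := by
    ext i
    cases i using Fin.cases <;> simp
  map_smul' a x := by
    ext i
    cases i using Fin.cases <;> simp

/-- The parametrization of `tangentSpan` by the multiples of the points `p j` and the directions
with zeroth coordinate zero. -/
noncomputable def tangentParam (K : Type*) [Field K] {k s : ℕ} (n : Fin k → ℕ)
    (p : Fin s → ∀ i, Fin (n i + 1) → K) :
    (Fin s → K × ∀ i, (Fin (n i) → K)) →ₗ[K] ⨂[K] i, (Fin (n i + 1) → K) :=
  ∑ j, ((LinearMap.fst K K _).smulRight (tprod K (p j)) +
    (∑ i, ((PiTensorProduct.tprod K).toLinearMap (p j) i ∘ₗ consZero K (n i)) ∘ₗ LinearMap.proj i) ∘ₗ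
      LinearMap.snd K K _) ∘ₗ LinearMap.proj j

variable {K : Type*} [Field K] {k s : ℕ}

theorem tangentParam_apply (n : Fin k → ℕ) (p : Fin s → ∀ i, Fin (n i + 1) → K)
    (z : Fin s → K × ∀ i, (Fin (n i) → K)) :
    tangentParam K n p z = ∑ j, ((z j).1 • tprod K (p j) +
      ∑ i, tprod K (Function.update (p j) i (Fin.cons 0 ((z j).2 i)))) := by
  simp [tangentParam, LinearMap.sum_apply, consZero]

theorem tprod_update_mem_tangentSpan (n : Fin k → ℕ) (p : Fin s → ∀ i, Fin (n i + 1) → K)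
    (j : Fin s) (i : Fin k) (y : Fin (n i + 1) → K) :
    tprod K (Function.update (p j) i y) ∈ tangentSpan K n p :=
  Submodule.mem_iSup_of_mem j (Submodule.mem_iSup_of_mem i ⟨y, rfl⟩)

theorem tangentSpan_le_iff {n : Fin k → ℕ} {p : Fin s → ∀ i, Fin (n i + 1) → K}
    {S : Submodule K (⨂[K] i, (Fin (n i + 1) → K))} :
    tangentSpan K n p ≤ S ↔ ∀ j i y, tprod K (Function.update (p j) i y) ∈ S := by
  refine ⟨fun h j i y => h (tprod_update_mem_tangentSpan n p j i y), fun h => ?_⟩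
  refine iSup_le fun j => iSup_le fun i => ?_
  rintro _ ⟨y, rfl⟩
  exact h j i y

theorem range_tangentParam [NeZero k] {n : Fin k → ℕ} {p : Fin s → ∀ i, Fin (n i + 1) → K}
    (hp : ∀ j i, p j i 0 = 1) : LinearMap.range (tangentParam K n p) = tangentSpan K n p := by
  apply le_antisymm
  · rintro _ ⟨z, rfl⟩
    rw [tangentParam_apply]
    refine Submodule.sum_mem _ fun j _ => Submodule.add_mem _ (Submodule.smul_mem _ _ ?_)
      (Submodule.sum_mem _ fun i _ => tprod_update_mem_tangentSpan n p j i _)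
    simpa using tprod_update_mem_tangentSpan n p j 0 (p j 0)
  · rw [tangentSpan_le_iff]
    intro j i y
    refine ⟨Pi.single j (y 0, Pi.single i fun h => y h.succ - y 0 * p j i h.succ), ?_⟩
    rw [tangentParam_apply, sum_eq_single j]
    · simp only [Pi.single_eq_same]
      rw [sum_eq_single i]
      · rw [Pi.single_eq_same]
        have h1 : PiTensorProduct.tprod K (p j) =
            PiTensorProduct.tprod K (Function.update (p j) i (p j i)) := by
          rw [Function.update_eq_self]
        rw [h1, ← (PiTensorProduct.tprod K).map_update_smul,
          ← (PiTensorProduct.tprod K).map_update_add]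
        congr 2
        ext h
        cases h using Fin.cases <;> simp [hp]
      · intro b _ hb
        simp only [Pi.single_eq_of_ne hb]
        refine (PiTensorProduct.tprod K).map_coord_zero b ?_
        rw [Function.update_self]
        ext h
        cases h using Fin.cases <;> simp
      · simp
    · intro b _ hb
      rw [Pi.single_eq_of_ne hb]
      simp only [Prod.fst_zero, zero_smul, zero_add]
      refine sum_eq_zero fun i _ => (PiTensorProduct.tprod K).map_coord_zero i ?_
      rw [Function.update_self]
      ext h
      cases h using Fin.cases <;> simp
    · simp

theorem finrank_tangentParam_domain (n : Fin k → ℕ) :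
    Module.finrank K (Fin s → K × ∀ i, (Fin (n i) → K)) = s * (1 + ∑ i, n i) := by
  simp [Module.finrank_pi_fintype]

theorem finrank_tangentSpan_le [NeZero k] {n : Fin k → ℕ} {p : Fin s → ∀ i, Fin (n i + 1) → K}
    (hp : ∀ j i, p j i 0 = 1) : Module.finrank K (tangentSpan K n p) ≤ s * (1 + ∑ i, n i) := by
  rw [← range_tangentParam hp, ← finrank_tangentParam_domain (K := K) n]
  exact LinearMap.finrank_range_le _

theorem finrank_tangentSpan_of_injective [NeZero k] {n : Fin k → ℕ}
    {p : Fin s → ∀ i, Fin (n i + 1) → K} (hp : ∀ j i, p j i 0 = 1)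
    (h : Function.Injective (tangentParam K n p)) :
    Module.finrank K (tangentSpan K n p) = s * (1 + ∑ i, n i) := by
  rw [← range_tangentParam hp, ← finrank_tangentParam_domain (K := K) n]
  exact LinearMap.finrank_range_of_inj h

/-- The standard basis of the space of tensors. -/
noncomputable def tensorBasis (K : Type*) [Field K] {k : ℕ} (n : Fin k → ℕ) :
    Module.Basis (∀ i, Fin (n i + 1)) K (⨂[K] i, (Fin (n i + 1) → K)) :=
  Basis.piTensorProduct fun _ => Pi.basisFun K _

theorem finrank_tensor (n : Fin k → ℕ) :
    Module.finrank K (⨂[K] i, (Fin (n i + 1) → K)) = ∏ i, (n i + 1) := by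
  rw [Module.finrank_eq_card_basis (tensorBasis K n)]
  simp

theorem tensorBasis_repr_tprod (n : Fin k → ℕ) (w : ∀ i, Fin (n i + 1) → K)
    (I : ∀ i, Fin (n i + 1)) : (tensorBasis K n).repr (tprod K w) I = ∏ i, w i (I i) := by
  simp [tensorBasis, Basis.piTensorProduct_repr_tprod_apply]

instance (n : Fin k → ℕ) : FiniteDimensional K (⨂[K] i, (Fin (n i + 1) → K)) :=
  Module.Finite.of_basis (tensorBasis K n)

theorem finrank_tangentSpan_le_prod (n : Fin k → ℕ) (p : Fin s → ∀ i, Fin (n i + 1) → K) :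
    Module.finrank K (tangentSpan K n p) ≤ ∏ i, (n i + 1) := by
  rw [← finrank_tensor (K := K)]
  exact Submodule.finrank_le _

theorem prod_update_eq {n : ℕ → ℕ} (w : ∀ i : Fin k, Fin (n i + 1) → K) (v : ℕ → ℕ → K)
    (hw : ∀ i h, w i h = v i h) (i : Fin k) (y : Fin (n i + 1) → K) (I : ℕ → ℕ)
    (hI : ∀ l : Fin k, I l < n l + 1) :
    ∏ l, Function.update w i y l ⟨I l, hI l⟩ =
      y ⟨I i, hI i⟩ * ∏ l ∈ (range k).erase i, v l (I l) := by
  have h1 : ∀ l : Fin k, Function.update w i y l ⟨I l, hI l⟩ =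
      if (l : ℕ) = i then y ⟨I i, hI i⟩ else v l (I l) := by
    intro l
    split_ifs with h
    · obtain rfl := Fin.ext h
      rw [Function.update_self]
    · rw [Function.update_of_ne fun h' => h (congrArg _ h'), hw]
  rw [prod_congr rfl fun l _ => h1 l,
    ← prod_range (fun l => if l = (i : ℕ) then y ⟨I i, hI i⟩ else v l (I l)),
    ← mul_prod_erase _ _ (mem_range.2 i.2), if_pos rfl]
  congr 1
  exact prod_congr rfl fun l hl => if_neg (ne_of_mem_erase hl)

theorem injective_tangentParam_of_tangentIndep {n : ℕ → ℕ} {v : ℕ → ℕ → ℕ → K}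
    (H : TangentIndep K s k n v) :
    Function.Injective (tangentParam K (fun i : Fin k => n i)
      fun (j : Fin s) i (h : Fin (n i + 1)) => v j i h) := by
  refine (injective_iff_map_eq_zero _).2 fun z hz => ?_
  rw [tangentParam_apply] at hz
  have := H (fun j => if hj : j < s then (z ⟨j, hj⟩).1 else 0)
    (fun j i h => if hj : j < s then if hi : i < k then if hh : h < n i + 1 then
      (Fin.cons 0 ((z ⟨j, hj⟩).2 ⟨i, hi⟩) : Fin (n i + 1) → K) ⟨h, hh⟩ else 0 else 0 else 0)
    (fun j i => by
      split_ifs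
      · rfl
      all_goals rfl)
    (fun I hI => by
      have hI' : ∀ l : Fin k, I l < n l + 1 := fun l => Nat.lt_succ_of_le (hI l l.2)
      have := congrArg (fun t => (tensorBasis K fun i : Fin k => n i).repr t
        fun l => ⟨I l, hI' l⟩) hz
      simp only [map_sum, map_add, map_smul, Finsupp.coe_finsetSum, Finset.sum_apply,
        Finsupp.add_apply, Finsupp.smul_apply, map_zero, Finsupp.coe_zero, Pi.zero_apply,
        tensorBasis_repr_tprod, smul_eq_mul] at this
      refine Eq.trans ?_ this
      rw [Finset.sum_range]
      refine sum_congr rfl fun j _ => ?_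
      congr 1
      · rw [dif_pos j.2, prod_range]
      · rw [Finset.sum_range]
        refine sum_congr rfl fun i _ => ?_
        rw [prod_update_eq _ (v j) (fun _ _ => rfl) i _ I hI', dif_pos j.2, dif_pos i.2,
          dif_pos (hI' i)])
  ext j i
  · simpa using (this j j.2).1
  · rename_i h
    have := (this j j.2).2 i i.2 (h + 1) h.2
    rw [dif_pos j.2, dif_pos i.2, dif_pos (by simp)] at this
    exact this

end TangentParametrization

section NonDefective

open Finset

variable {K : Type*} [Field K] {k s : ℕ}

theorem iSup_segreG_eq_bot (n : Fin k → ℕ)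
    (q : ∀ i : Fin k, Fin ((fun _ => 0 : Fin k → ℕ) i) → ∀ j, Fin (n j + 1) → K) :
    ⨆ i, ⨆ l, segreG K n (q i l) i = ⊥ :=
  iSup_eq_bot.2 fun _ => iSup_eq_bot.2 fun l => l.elim0

theorem tHolds_of_finrank_eq {n : Fin k → ℕ} (p : Fin s → ∀ i, Fin (n i + 1) → K)
    (hp : ∀ j i, p j i ≠ 0)
    (h : Module.finrank K (tangentSpan K n p) = min (s * (1 + ∑ i, n i)) (∏ i, (n i + 1))) :
    THolds K n s fun _ => 0 := by
  refine ⟨p, fun _ l => l.elim0, hp, fun _ l => l.elim0, ?_⟩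
  rw [iSup_segreG_eq_bot, sup_bot_eq]
  simp only [zero_mul, sum_const_zero, add_zero]
  exact h

theorem tFails_of_finrank_lt {n : Fin k → ℕ}
    (h : ∀ p : Fin s → ∀ i, Fin (n i + 1) → K,
      Module.finrank K (tangentSpan K n p) < min (s * (1 + ∑ i, n i)) (∏ i, (n i + 1))) :
    TFails K n s fun _ => 0 := by
  intro p q _ _
  rw [iSup_segreG_eq_bot, sup_bot_eq]
  simp only [zero_mul, sum_const_zero, add_zero]
  exact h p

theorem ne_zero_of_apply_zero_eq_one {m : ℕ} {x : Fin (m + 1) → K} (h : x 0 = 1) : x ≠ 0 := by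
  rintro rfl
  exact zero_ne_one h

theorem tHolds_of_injective_tangentParam [NeZero k] {n : Fin k → ℕ}
    {p : Fin s → ∀ i, Fin (n i + 1) → K} (hp : ∀ j i, p j i 0 = 1)
    (h : Function.Injective (tangentParam K n p)) : THolds K n s fun _ => 0 := by
  have h1 := finrank_tangentSpan_of_injective hp h
  refine tHolds_of_finrank_eq p (fun j i => ne_zero_of_apply_zero_eq_one (hp j i)) ?_
  rw [h1, min_eq_left]
  rw [← h1]
  exact finrank_tangentSpan_le_prod n p

theorem tHolds_of_tangentSpan_eq_top [NeZero k] {n : Fin k → ℕ}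
    {p : Fin s → ∀ i, Fin (n i + 1) → K} (hp : ∀ j i, p j i 0 = 1)
    (h : tangentSpan K n p = ⊤) : THolds K n s fun _ => 0 := by
  have h1 : Module.finrank K (tangentSpan K n p) = ∏ i, (n i + 1) := by
    rw [h, finrank_top, finrank_tensor]
  refine tHolds_of_finrank_eq p (fun j i => ne_zero_of_apply_zero_eq_one (hp j i)) ?_
  rw [h1, min_eq_right]
  rw [← h1]
  exact finrank_tangentSpan_le hp

theorem eq_top_of_tprod_mem {n : Fin k → ℕ} {S : Submodule K (⨂[K] i, (Fin (n i + 1) → K))}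
    (h : ∀ w, PiTensorProduct.tprod K w ∈ S) : S = ⊤ := by
  rw [eq_top_iff, ← PiTensorProduct.span_tprod_eq_top, Submodule.span_le]
  rintro _ ⟨w, rfl⟩
  exact h w

theorem tangentSpan_eq_top_of_surjective {n₀ n : Fin k → ℕ}
    (f : ∀ i, (Fin (n₀ i + 1) → K) →ₗ[K] (Fin (n i + 1) → K))
    (hf : ∀ i, Function.Surjective (f i)) {p : Fin s → ∀ i, Fin (n₀ i + 1) → K}
    (h : tangentSpan K n₀ p = ⊤) : tangentSpan K n (fun j i => f i (p j i)) = ⊤ := by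
  have hle : tangentSpan K n₀ p ≤
      (tangentSpan K n fun j i => f i (p j i)).comap (PiTensorProduct.map f) := by
    rw [tangentSpan_le_iff]
    intro j i y
    have : (fun l => f l (Function.update (p j) i y l)) =
        Function.update (fun l => f l (p j l)) i (f i y) := by
      ext1 l
      by_cases hl : l = i
      · subst hl
        simp
      · simp [hl]
    rw [Submodule.mem_comap, PiTensorProduct.map_tprod, this]
    exact tprod_update_mem_tangentSpan n (fun j i => f i (p j i)) j i (f i y)
  rw [h, top_le_iff] at hle
  refine eq_top_of_tprod_mem fun w => ?_
  choose w' hw' using fun i => hf i (w i)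
  have : PiTensorProduct.tprod K w' ∈
      (tangentSpan K n fun j i => f i (p j i)).comap (PiTensorProduct.map f) := by
    rw [hle]
    trivial
  rw [Submodule.mem_comap, PiTensorProduct.map_tprod] at this
  simpa only [hw'] using this

theorem tHolds_of_exists_tangentIndep [NeZero k] {k₀ : ℕ} {n₀ : ℕ → ℕ} (n : Fin k → ℕ)
    (hk : k₀ ≤ k)
    (hn : ∀ a (h : a < k₀), 1 ≤ n₀ a ∧ n₀ a ≤ n ⟨a, h.trans_le hk⟩)
    (h : ∃ v : ℕ → ℕ → ℕ → K, (∀ j < s, ∀ l < k₀, v j l 0 = 1) ∧ TangentIndep K s k₀ n₀ v) :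
    THolds K n s fun _ => 0 := by
  obtain ⟨v, hv, H⟩ := h
  obtain ⟨n', rfl⟩ : ∃ n' : ℕ → ℕ, n = fun i : Fin k => n' i :=
    ⟨fun l => if h : l < k then n ⟨l, h⟩ else 0, by simp⟩
  exact tHolds_of_injective_tangentParam (fun j i => extendCoord_zero hv j.2 i)
    (injective_tangentParam_of_tangentIndep (H.extend hk fun a ha => hn a ha))

theorem tHolds_of_le_of_exists_tangentIndep [NeZero k] {n₀ : ℕ → ℕ} (n : Fin k → ℕ)
    (hn : ∀ i : Fin k, n i ≤ n₀ i)
    (hperfect : s * (1 + ∑ i : Fin k, n₀ i) = ∏ i : Fin k, (n₀ i + 1))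
    (h : ∃ v : ℕ → ℕ → ℕ → K, (∀ j < s, ∀ l < k, v j l 0 = 1) ∧ TangentIndep K s k n₀ v) :
    THolds K n s fun _ => 0 := by
  obtain ⟨v, hv, H⟩ := h
  have htop : tangentSpan K (fun i : Fin k => n₀ i)
      (fun (j : Fin s) i (h : Fin (n₀ i + 1)) => v j i h) = ⊤ := by
    refine Submodule.eq_top_of_finrank_eq ?_
    rw [finrank_tangentSpan_of_injective (fun j i => hv j j.2 i i.2)
      (injective_tangentParam_of_tangentIndep H), finrank_tensor, hperfect]
  have hle : ∀ i : Fin k, n i + 1 ≤ n₀ i + 1 := fun i => Nat.succ_le_succ (hn i)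
  exact tHolds_of_tangentSpan_eq_top (fun j i => hv j j.2 i i.2)
    (tangentSpan_eq_top_of_surjective (fun i => LinearMap.funLeft K K (Fin.castLE (hle i)))
      (fun i => LinearMap.funLeft_surjective_of_injective K K _ (Fin.castLE_injective (hle i)))
      htop)

theorem tprod_mem_of_span_eq_top {n : Fin k → ℕ} {S : Submodule K (⨂[K] i, (Fin (n i + 1) → K))}
    (w : ∀ i, Fin (n i + 1) → K) (i : Fin k) {B : Set (Fin (n i + 1) → K)}
    (hB : Submodule.span K B = ⊤)
    (h : ∀ b ∈ B, PiTensorProduct.tprod K (Function.update w i b) ∈ S) :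
    PiTensorProduct.tprod K w ∈ S := by
  have h1 : Submodule.span K B ≤ S.comap ((PiTensorProduct.tprod K).toLinearMap w i) :=
    Submodule.span_le.2 h
  have h2 : w i ∈ S.comap ((PiTensorProduct.tprod K).toLinearMap w i) := h1 (hB ▸ trivial)
  simpa using h2

theorem span_single_const_eq_top {m : ℕ} (hm : m = 1) :
    Submodule.span K ({Pi.single 0 1, fun _ => 1} : Set (Fin (m + 1) → K)) = ⊤ := by
  subst hm
  rw [eq_top_iff]
  intro x _
  rw [Submodule.mem_span_pair]
  refine ⟨x 0 - x 1, x 1, ?_⟩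
  ext i
  fin_cases i <;> simp

theorem tHolds_one_one (n : Fin 3 → ℕ) (h0 : n 0 = 1) (h1 : n 1 = 1) :
    THolds K n 5 fun _ => 0 := by
  let p : Fin 5 → ∀ i, Fin (n i + 1) → K := fun j i =>
    if (i = 0 ∧ (j = 1 ∨ j = 3)) ∨ (i = 1 ∧ (j = 2 ∨ j = 3)) then fun _ => 1 else Pi.single 0 1
  refine tHolds_of_tangentSpan_eq_top (p := p) (fun j i => ?_) (eq_top_of_tprod_mem fun w => ?_)
  · dsimp only [p]
    split_ifs <;> simp
  · refine tprod_mem_of_span_eq_top w 0 (span_single_const_eq_top h0) fun b hb => ?_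
    refine tprod_mem_of_span_eq_top _ 1 (span_single_const_eq_top h1) fun b' hb' => ?_
    have key : ∀ j, p j 0 = b → p j 1 = b' →
        PiTensorProduct.tprod K (Function.update (Function.update w 0 b) 1 b') ∈
          tangentSpan K n p := by
      intro j hj hj'
      have : Function.update (Function.update w 0 b) 1 b' = Function.update (p j) 2 (w 2) := by
        ext1 i
        fin_cases i <;> simp [Function.update, hj, hj']
      rw [this]
      exact tprod_update_mem_tangentSpan n p j 2 (w 2)
    rcases hb with rfl | rfl <;> rcases hb' with rfl | rfl
    · exact key 0 (by simp [p]) (by simp [p])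
    · exact key 2 (by simp [p]) (by simp [p])
    · exact key 1 (by simp [p]) (by simp [p])
    · exact key 3 (by simp [p]) (by simp [p])

theorem tHolds_of_three [CharZero K] (n : Fin 3 → ℕ) (hmono : Monotone n) (hpos : ∀ i, 1 ≤ n i)
    (h1 : ¬(n 0 = 2 ∧ n 1 = 3 ∧ n 2 = 3)) (h2 : ¬(n 0 = 1 ∧ n 1 = 2 ∧ 5 ≤ n 2))
    (h3 : ¬(n 0 = 1 ∧ n 1 = 3 ∧ 5 ≤ n 2)) : THolds K n 5 fun _ => 0 := by
  have h01 : n 0 ≤ n 1 := hmono (by decide)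
  have h12 : n 1 ≤ n 2 := hmono (by decide)
  have h0 := hpos 0
  by_cases h144 : n 0 ≤ 1 ∧ n 1 ≤ 4 ∧ n 2 ≤ 4
  · refine tHolds_of_le_of_exists_tangentIndep n ?_ (by decide)
      (exists_tangentIndep_one_four_four K)
    simp [Fin.forall_fin_succ, tuple, h144]
  by_cases h224 : n 0 ≤ 2 ∧ n 1 ≤ 2 ∧ n 2 ≤ 4
  · refine tHolds_of_le_of_exists_tangentIndep n ?_ (by decide)
      (exists_tangentIndep_two_two_four K)
    simp [Fin.forall_fin_succ, tuple, h224]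
  by_cases h144' : 1 ≤ n 0 ∧ 4 ≤ n 1 ∧ 4 ≤ n 2
  · refine tHolds_of_exists_tangentIndep n le_rfl ?_ (exists_tangentIndep_one_four_four K)
    intro a ha
    interval_cases a <;> simp [tuple, h144']
  by_cases h224' : 2 ≤ n 0 ∧ 2 ≤ n 1 ∧ 4 ≤ n 2
  · refine tHolds_of_exists_tangentIndep n le_rfl ?_ (exists_tangentIndep_two_two_four K)
    intro a ha
    interval_cases a <;> simp [tuple, h224']
  by_cases h333 : 3 ≤ n 0 ∧ 3 ≤ n 1 ∧ 3 ≤ n 2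
  · refine tHolds_of_exists_tangentIndep n le_rfl ?_ (exists_tangentIndep_three_three_three K)
    intro a ha
    interval_cases a <;> simp [tuple, h333]
  exact tHolds_one_one n (by omega) (by omega)

theorem tHolds_of_four [CharZero K] (n : Fin 4 → ℕ) (hmono : Monotone n) (hpos : ∀ i, 1 ≤ n i)
    (h : ¬(n 0 = 1 ∧ n 1 = 1 ∧ n 2 = 2 ∧ n 3 = 2)) : THolds K n 5 fun _ => 0 := by
  have h01 : n 0 ≤ n 1 := hmono (by decide)
  have h12 : n 1 ≤ n 2 := hmono (by decide)
  have h23 : n 2 ≤ n 3 := hmono (by decide)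
  have h0 := hpos 0
  by_cases h1114 : n 0 ≤ 1 ∧ n 1 ≤ 1 ∧ n 2 ≤ 1 ∧ n 3 ≤ 4
  · refine tHolds_of_le_of_exists_tangentIndep n ?_ (by decide)
      (exists_tangentIndep_one_one_one_four K)
    simp [Fin.forall_fin_succ, tuple, h1114]
  by_cases h1114' : 1 ≤ n 0 ∧ 1 ≤ n 1 ∧ 1 ≤ n 2 ∧ 4 ≤ n 3
  · refine tHolds_of_exists_tangentIndep n le_rfl ?_ (exists_tangentIndep_one_one_one_four K)
    intro a ha
    interval_cases a <;> simp [tuple, h1114']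
  by_cases h1123 : 1 ≤ n 0 ∧ 1 ≤ n 1 ∧ 2 ≤ n 2 ∧ 3 ≤ n 3
  · refine tHolds_of_exists_tangentIndep n le_rfl ?_ (exists_tangentIndep_one_one_two_three K)
    intro a ha
    interval_cases a <;> simp [tuple, h1123]
  have h1222 : 1 ≤ n 0 ∧ 2 ≤ n 1 ∧ 2 ≤ n 2 ∧ 2 ≤ n 3 := by omega
  refine tHolds_of_exists_tangentIndep n le_rfl ?_ (exists_tangentIndep_one_two_two_two K)
  intro a ha
  interval_cases a <;> simp [tuple, h1222]

theorem tHolds_of_five_le [CharZero K] (hk : 5 ≤ k) (n : Fin k → ℕ) (hpos : ∀ i, 1 ≤ n i) :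
    THolds K n 5 fun _ => 0 := by
  have : NeZero k := ⟨by omega⟩
  refine tHolds_of_exists_tangentIndep n hk ?_ (exists_tangentIndep_one_one_one_one_one K)
  intro a ha
  interval_cases a <;> simp [tuple, hpos]

end NonDefective

section Annihilators

open Finset

variable {K : Type*} [Field K] {k s : ℕ}

theorem LinearMap.exists_linearIndependent_ker {W U : Type*} [AddCommGroup W] [Module K W]
    [FiniteDimensional K W] [AddCommGroup U] [Module K U] [FiniteDimensional K U]
    (T : W →ₗ[K] U) {m : ℕ} (h : m + Module.finrank K U ≤ Module.finrank K W) :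
    ∃ f : Fin m → W, LinearIndependent K f ∧ ∀ i, T (f i) = 0 := by
  have h1 := T.finrank_range_add_finrank_ker
  have h2 := Submodule.finrank_le (LinearMap.range T)
  obtain ⟨f, hf⟩ := exists_linearIndependent_of_le_finrank
    (show m ≤ Module.finrank K (LinearMap.ker T) by omega)
  exact ⟨fun i => f i, hf.map' (LinearMap.ker T).subtype (Submodule.ker_subtype _),
    fun i => (f i).2⟩

theorem finrank_tangentSpan_add_card_le {n : Fin k → ℕ} {p : Fin s → ∀ i, Fin (n i + 1) → K}
    {ι : Type*} [Fintype ι] {f : ι → MultilinearMap K (fun i : Fin k => Fin (n i + 1) → K) K}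
    (hf : LinearIndependent K f) (h : ∀ a j i y, f a (Function.update (p j) i y) = 0) :
    Module.finrank K (tangentSpan K n p) + Fintype.card ι ≤ ∏ i, (n i + 1) := by
  have hmem : ∀ a, PiTensorProduct.lift (f a) ∈ (tangentSpan K n p).dualAnnihilator := by
    intro a
    have hle : tangentSpan K n p ≤ LinearMap.ker (PiTensorProduct.lift (f a)) := by
      rw [tangentSpan_le_iff]
      intro j i y
      rw [LinearMap.mem_ker, PiTensorProduct.lift.tprod, h]
    rw [Submodule.mem_dualAnnihilator]
    exact fun w hw => hle hw
  have hli : LinearIndependent K fun a =>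
      (⟨PiTensorProduct.lift (f a), hmem a⟩ : (tangentSpan K n p).dualAnnihilator) :=
    LinearIndependent.of_comp (tangentSpan K n p).dualAnnihilator.subtype
      (hf.map' PiTensorProduct.lift.toLinearMap (LinearEquiv.ker _))
  have h1 := hli.fintype_card_le_finrank
  have h2 := Subspace.finrank_add_finrank_dualAnnihilator_eq (tangentSpan K n p)
  rw [finrank_tensor] at h2
  omega

/-- A function on a finite product of vector spaces which is linear in each variable, bundled
as a multilinear map. -/
def MultilinearMap.ofIsLinearMap {V : Fin k → Type*} [∀ i, AddCommGroup (V i)]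
    [∀ i, Module K (V i)] (f : (∀ i, V i) → K)
    (h : ∀ x i, IsLinearMap K fun y => f (Function.update x i y)) : MultilinearMap K V K where
  toFun := f
  map_update_add' x i a b := by
    convert (h x i).map_add a b
  map_update_smul' x i c a := by
    convert (h x i).map_smul c a

/-- The trilinear form that is the product of a bilinear form in the first two variables and
a linear form in the third. -/
def bilinMulForm {V : Fin 3 → Type*} [∀ i, AddCommGroup (V i)] [∀ i, Module K (V i)]
    (f : V 0 →ₗ[K] V 1 →ₗ[K] K) (g : V 2 →ₗ[K] K) : MultilinearMap K V K :=
  MultilinearMap.ofIsLinearMap (fun x => f (x 0) (x 1) * g (x 2)) fun x i => by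
    fin_cases i <;> constructor <;> intros <;> simp [Function.update] <;> ring

theorem linearIndependent_bilinMulForm {V : Fin 3 → Type*} [∀ i, AddCommGroup (V i)]
    [∀ i, Module K (V i)] {ι κ : Type*} [Fintype ι] [Fintype κ] {f : ι → V 0 →ₗ[K] V 1 →ₗ[K] K}
    {g : κ → V 2 →ₗ[K] K} (hf : LinearIndependent K f) (hg : LinearIndependent K g) :
    LinearIndependent K fun a : ι × κ => bilinMulForm (V := V) (f a.1) (g a.2) := by
  have hf := (Fintype.linearIndependent_iff (R := K) (v := f)).1 hf
  have hg := (Fintype.linearIndependent_iff (R := K) (v := g)).1 hg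
  rw [Fintype.linearIndependent_iff]
  intro c hc a
  refine hg (fun b => c (a.1, b)) (LinearMap.ext fun z => ?_) a.2
  have := hf (fun a => ∑ b, c (a, b) * g b z) (LinearMap.ext₂ fun x y => ?_) a.1
  · simpa [LinearMap.sum_apply] using this
  · have h1 := congrArg (fun F => F fun i => Fin.cases x (Fin.cases y (Fin.cases z
      fun i => i.elim0)) i) hc
    rw [Fintype.sum_prod_type] at h1
    simp only [_root_.sum_apply, _root_.smul_apply, _root_.zero_apply,
      smul_eq_mul] at h1
    simp only [LinearMap.sum_apply, LinearMap.smul_apply, LinearMap.zero_apply, smul_eq_mul]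
    rw [← h1]
    refine sum_congr rfl fun a _ => ?_
    rw [sum_mul]
    refine sum_congr rfl fun b _ => ?_
    change c (a, b) * g b z * f a x y = c (a, b) * (f a x y * g b z)
    ring

theorem finrank_tangentSpan_add_mul_le {n : Fin 3 → ℕ} (p : Fin s → ∀ i, Fin (n i + 1) → K)
    {m₁ m₂ : ℕ} (h₁ : m₁ + s ≤ (n 0 + 1) * (n 1 + 1)) (h₂ : m₂ + s ≤ n 2 + 1) :
    Module.finrank K (tangentSpan K n p) + m₁ * m₂ ≤ ∏ i, (n i + 1) := by
  obtain ⟨f, hf, hf'⟩ := LinearMap.exists_linearIndependent_ker (K := K) (m := m₁)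
    (W := (Fin (n 0 + 1) → K) →ₗ[K] (Fin (n 1 + 1) → K) →ₗ[K] K) (U := Fin s → K)
    (LinearMap.pi fun j : Fin s => (LinearMap.applyₗ (R := K) (p j 1)) ∘ₗ
      (LinearMap.applyₗ (R := K) (M₂ := (Fin (n 1 + 1) → K) →ₗ[K] K) (p j 0)))
    (by simpa [Module.finrank_linearMap] using h₁)
  obtain ⟨g, hg, hg'⟩ := LinearMap.exists_linearIndependent_ker (K := K) (m := m₂)
    (W := (Fin (n 2 + 1) → K) →ₗ[K] K) (U := Fin s → K)
    (LinearMap.pi fun j : Fin s => LinearMap.applyₗ (R := K) (M₂ := K) (p j 2))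
    (by simpa [Module.finrank_linearMap] using h₂)
  have hf0 : ∀ a j, f a (p j 0) (p j 1) = 0 := fun a j => congrFun (hf' a) j
  have hg0 : ∀ b j, g b (p j 2) = 0 := fun b j => congrFun (hg' b) j
  have := finrank_tangentSpan_add_card_le (p := p)
    (linearIndependent_bilinMulForm (V := fun i => Fin (n i + 1) → K) hf hg) (by
    rintro ⟨a, b⟩ j i y
    change f a (Function.update (p j) i y 0) (Function.update (p j) i y 1) *
      g b (Function.update (p j) i y 2) = 0
    fin_cases i <;> simp [Function.update, hf0, hg0])
  simpa using this

theorem tFails_one_two (n : Fin 3 → ℕ) (h0 : n 0 = 1) (h1 : n 1 = 2) (h2 : 5 ≤ n 2) :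
    TFails K n 5 fun _ => 0 := by
  refine tFails_of_finrank_lt fun p => ?_
  have := finrank_tangentSpan_add_mul_le p (m₁ := 1) (m₂ := n 2 - 4) (by rw [h0, h1])
    (by omega)
  rw [Fin.sum_univ_three]
  rw [Fin.prod_univ_three] at this ⊢
  rw [h0, h1] at this ⊢
  rw [lt_min_iff]
  omega

theorem tFails_one_three (n : Fin 3 → ℕ) (h0 : n 0 = 1) (h1 : n 1 = 3) (h2 : 5 ≤ n 2) :
    TFails K n 5 fun _ => 0 := by
  refine tFails_of_finrank_lt fun p => ?_
  have := finrank_tangentSpan_add_mul_le p (m₁ := 3) (m₂ := n 2 - 4) (by rw [h0, h1])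
    (by omega)
  rw [Fin.sum_univ_three]
  rw [Fin.prod_univ_three] at this ⊢
  rw [h0, h1] at this ⊢
  rw [lt_min_iff]
  omega

end Annihilators

section GeneralPosition

open Finset Polynomial Filter

variable {K : Type*} [Field K] {k s : ℕ}

theorem eventually_linearIndependent_eval {ι m : Type*} [Finite ι] [Finite m]
    (u : ι → m → K[X]) {t₀ : K} (h : LinearIndependent K fun a b => (u a b).eval t₀) :
    ∀ᶠ t in cofinite, LinearIndependent K fun a b => (u a b).eval t := by
  classical
  have := Fintype.ofFinite ι
  have := Fintype.ofFinite m
  obtain ⟨B, hB⟩ := Matrix.exists_mul_eq_one_of_linearIndependent_row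
    (A := Matrix.of fun a b => (u a b).eval t₀) h
  have hdet : ∀ t, (Matrix.of u * B.map C).det.eval t =
      (Matrix.of (fun a b => (u a b).eval t) * B).det := by
    intro t
    rw [← coe_evalRingHom, RingHom.map_det, RingHom.mapMatrix_apply]
    congr 1
    ext a b
    simp [Matrix.mul_apply, eval_finsetSum]
  have hne : (Matrix.of u * B.map C).det ≠ 0 := by
    intro h0
    have h1 := hdet t₀
    rw [hB, h0, Matrix.det_one, eval_zero] at h1
    exact zero_ne_one h1
  refine ((Matrix.of u * B.map C).det.rootSet_finite K).subset ?_
  intro t ht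
  rw [mem_rootSet_of_ne hne, coe_aeval_eq_eval, hdet]
  by_contra h0
  exact ht (Matrix.linearIndependent_row_of_det_mul_ne_zero B h0)

theorem tprod_update_single_repr {n : Fin k → ℕ} (w : ∀ i, Fin (n i + 1) → K) (i : Fin k)
    (h : Fin (n i + 1)) (I : ∀ i, Fin (n i + 1)) :
    (tensorBasis K n).repr (PiTensorProduct.tprod K (Function.update w i (Pi.single h 1))) I =
      (if I i = h then 1 else 0) * ∏ l ∈ univ.erase i, w l (I l) := by
  rw [tensorBasis_repr_tprod, ← mul_prod_erase _ _ (mem_univ i), Function.update_self,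
    Pi.single_apply]
  congr 1
  exact prod_congr rfl fun l hl => by rw [Function.update_of_ne (ne_of_mem_erase hl)]

theorem tangentSpan_eq_span (n : Fin k → ℕ) (p : Fin s → ∀ i, Fin (n i + 1) → K) :
    tangentSpan K n p = Submodule.span K (Set.range fun r : Fin s × Σ i, Fin (n i + 1) =>
      PiTensorProduct.tprod K (Function.update (p r.1) r.2.1 (Pi.single r.2.2 1))) := by
  apply le_antisymm
  · rw [tangentSpan_le_iff]
    intro j i y
    refine tprod_mem_of_span_eq_top _ i (Pi.basisFun K (Fin (n i + 1))).span_eq ?_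
    rintro _ ⟨h, rfl⟩
    rw [Function.update_idem, Pi.basisFun_apply]
    exact Submodule.subset_span ⟨(j, ⟨i, h⟩), rfl⟩
  · rw [Submodule.span_le]
    rintro _ ⟨r, rfl⟩
    exact tprod_update_mem_tangentSpan n p _ _ _

/-- The pencil of tuples of points through `p` (at `t = 0`) and `q` (at `t = 1`). -/
def pencil {n : Fin k → ℕ} (p q : Fin s → ∀ i, Fin (n i + 1) → K) (t : K) :
    Fin s → ∀ i, Fin (n i + 1) → K :=
  fun j i h => (1 - t) * p j i h + t * q j i h

theorem eventually_finrank_tangentSpan_le_pencil {n : Fin k → ℕ}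
    (p q : Fin s → ∀ i, Fin (n i + 1) → K) :
    ∀ᶠ t in cofinite, Module.finrank K (tangentSpan K n p) ≤
      Module.finrank K (tangentSpan K n (pencil p q t)) := by
  obtain ⟨κ, a, ha, hspan, hli⟩ := exists_linearIndependent' K
    fun r : Fin s × Σ i, Fin (n i + 1) =>
      PiTensorProduct.tprod K (Function.update (p r.1) r.2.1 (Pi.single r.2.2 1))
  have : Finite κ := Finite.of_injective a ha
  have := Fintype.ofFinite κ
  let u : κ → (∀ i, Fin (n i + 1)) → K[X] := fun b I =>
    C (if I (a b).2.1 = (a b).2.2 then 1 else 0) * ∏ l ∈ univ.erase (a b).2.1,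
      ((1 - X) * C (p (a b).1 l (I l)) + X * C (q (a b).1 l (I l)))
  have hu : ∀ t, (fun b I => (u b I).eval t) = fun b => (tensorBasis K n).equivFun
      (PiTensorProduct.tprod K (Function.update (pencil p q t (a b).1) (a b).2.1
        (Pi.single (a b).2.2 1))) := by
    intro t
    ext b I
    rw [Module.Basis.equivFun_apply, tprod_update_single_repr]
    simp only [u, pencil, eval_mul, eval_C, eval_prod, eval_add, eval_sub, eval_one, eval_X]
  have hp : pencil p q 0 = p := by
    ext j i h
    simp [pencil]
  have h0 : LinearIndependent K fun b I => (u b I).eval 0 := by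
    rw [hu, hp]
    exact hli.map' (tensorBasis K n).equivFun.toLinearMap (LinearEquiv.ker _)
  filter_upwards [eventually_linearIndependent_eval u h0] with t ht
  rw [hu] at ht
  have ht' := LinearIndependent.of_comp (tensorBasis K n).equivFun.toLinearMap ht
  rw [tangentSpan_eq_span, ← hspan, finrank_span_eq_card hli, ← finrank_span_eq_card ht']
  refine Submodule.finrank_mono ?_
  rw [Submodule.span_le]
  rintro _ ⟨b, rfl⟩
  exact tprod_update_mem_tangentSpan n _ _ _ _

/-- The points are in general position: in each factor, any subset of the expected size of
the points is a basis. -/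
def GeneralPosition {n : Fin k → ℕ} (p : Fin s → ∀ i, Fin (n i + 1) → K) : Prop :=
  ∀ i (e : Fin (n i + 1) ↪ Fin s), LinearIndependent K fun a => p (e a) i

theorem generalPosition_vandermonde [CharZero K] (n : Fin k → ℕ) :
    GeneralPosition fun (j : Fin s) i (h : Fin (n i + 1)) => ((j : ℕ) : K) ^ (h : ℕ) := by
  intro i e
  refine Matrix.linearIndependent_rows_of_det_ne_zero
    (A := Matrix.vandermonde fun a => ((e a : ℕ) : K)) ?_
  rw [Matrix.det_vandermonde_ne_zero_iff]
  intro a b hab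
  exact e.injective (Fin.ext (Nat.cast_injective hab))

theorem eventually_generalPosition_pencil {n : Fin k → ℕ} (p : Fin s → ∀ i, Fin (n i + 1) → K)
    {q : Fin s → ∀ i, Fin (n i + 1) → K} (hq : GeneralPosition q) :
    ∀ᶠ t in cofinite, GeneralPosition (pencil p q t) := by
  refine eventually_all.2 fun i => eventually_all.2 fun e => ?_
  let u : Fin (n i + 1) → Fin (n i + 1) → K[X] := fun a h =>
    (1 - X) * C (p (e a) i h) + X * C (q (e a) i h)
  have hu : ∀ t, (fun a h => (u a h).eval t) = fun a => pencil p q t (e a) i := by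
    intro t
    ext a h
    simp [u, pencil, mul_comm t]
  have h1 : (fun a h => (u a h).eval 1) = fun a => q (e a) i := by
    ext a h
    simp [u]
  have := eventually_linearIndependent_eval u (t₀ := 1) (by rw [h1]; exact hq i e)
  simpa only [hu] using this

theorem finrank_tangentSpan_le_of_generalPosition [CharZero K] {n : Fin k → ℕ} {r : ℕ}
    (h : ∀ p : Fin s → ∀ i, Fin (n i + 1) → K, GeneralPosition p →
      Module.finrank K (tangentSpan K n p) ≤ r) (p : Fin s → ∀ i, Fin (n i + 1) → K) :
    Module.finrank K (tangentSpan K n p) ≤ r := by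
  obtain ⟨t, ht, ht'⟩ := ((eventually_finrank_tangentSpan_le_pencil p _).and
    (eventually_generalPosition_pencil p (generalPosition_vandermonde n))).exists
  exact ht.trans (h _ ht')

theorem GeneralPosition.eq_zero_of_forall_mem {n : Fin k → ℕ}
    {p : Fin s → ∀ i, Fin (n i + 1) → K} (hp : GeneralPosition p) {i : Fin k} {M : Type*}
    [AddCommGroup M] [Module K M] (f : (Fin (n i + 1) → K) →ₗ[K] M) (t : Finset (Fin s))
    (ht : n i + 1 ≤ t.card) (h : ∀ j ∈ t, f (p j i) = 0) : f = 0 := by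
  obtain ⟨t', ht', hcard⟩ := exists_subset_card_eq ht
  let e := t'.orderEmbOfFin hcard
  have hli := hp i e.toEmbedding
  refine (basisOfLinearIndependentOfCardEqFinrank hli (by simp)).ext fun a => ?_
  rw [coe_basisOfLinearIndependentOfCardEqFinrank]
  exact h _ (ht' (orderEmbOfFin_mem t' hcard a))

end GeneralPosition

section Exceptional

open Finset

open scoped Matrix

variable {K : Type*} [Field K] {k s : ℕ}

theorem exists_bilin_ne_zero {W W' : Type*} [AddCommGroup W] [Module K W] [FiniteDimensional K W]
    [AddCommGroup W'] [Module K W'] [FiniteDimensional K W'] (a : Fin s → W) (b : Fin s → W')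
    (h : 1 + s ≤ Module.finrank K W * Module.finrank K W') :
    ∃ u : W →ₗ[K] W' →ₗ[K] K, u ≠ 0 ∧ ∀ j, u (a j) (b j) = 0 := by
  obtain ⟨f, hf, hf'⟩ := LinearMap.exists_linearIndependent_ker (K := K) (m := 1)
    (W := W →ₗ[K] W' →ₗ[K] K) (U := Fin s → K)
    (LinearMap.pi fun j : Fin s => (LinearMap.applyₗ (R := K) (b j)) ∘ₗ
      (LinearMap.applyₗ (R := K) (M₂ := W' →ₗ[K] K) (a j)))
    (by simpa [Module.finrank_linearMap] using h)
  exact ⟨f 0, hf.ne_zero 0, fun j => congrFun (hf' 0) j⟩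

theorem GeneralPosition.bilin_eq_zero {n : Fin k → ℕ} {p : Fin s → ∀ i, Fin (n i + 1) → K}
    (hp : GeneralPosition p) {i l : Fin k} (hs : n i + n l + 1 ≤ s)
    {u : (Fin (n i + 1) → K) →ₗ[K] (Fin (n l + 1) → K) →ₗ[K] K}
    (hu : ∀ j, u (p j i) (p j l) = 0) (α : (Fin (n i + 1) → K) →ₗ[K] K)
    (γ : (Fin (n l + 1) → K) →ₗ[K] K) (h : ∀ x y, u x y = α x * γ y) : u = 0 := by
  classical
  have hcard := card_filter_add_card_filter_not (s := univ) fun j => α (p j i) = 0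
  rw [card_univ, Fintype.card_fin] at hcard
  rcases le_or_gt (n i + 1) (univ.filter fun j => α (p j i) = 0).card with h1 | h1
  · have hα := hp.eq_zero_of_forall_mem α _ h1 fun j hj => (mem_filter.1 hj).2
    exact LinearMap.ext₂ fun x y => by simp [h, hα]
  · have hγ := hp.eq_zero_of_forall_mem γ (univ.filter fun j => ¬ α (p j i) = 0) (by omega)
      fun j hj => (mul_eq_zero.1 ((h _ _).symm.trans (hu j))).resolve_left (mem_filter.1 hj).2
    exact LinearMap.ext₂ fun x y => by simp [h, hγ]

/-- The quadrilinear form that is the product of a bilinear form in the first and third variables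
and one in the second and fourth. -/
def bilinMulBilin {V : Fin 4 → Type*} [∀ i, AddCommGroup (V i)] [∀ i, Module K (V i)]
    (u : V 0 →ₗ[K] V 2 →ₗ[K] K) (v : V 1 →ₗ[K] V 3 →ₗ[K] K) : MultilinearMap K V K :=
  MultilinearMap.ofIsLinearMap (fun x => u (x 0) (x 2) * v (x 1) (x 3)) fun x i => by
    fin_cases i <;> constructor <;> intros <;> simp [Function.update] <;> ring

/-- The quadrilinear form that is the product of a bilinear form in the first and fourth variables
and one in the second and third. -/
def bilinMulBilin' {V : Fin 4 → Type*} [∀ i, AddCommGroup (V i)] [∀ i, Module K (V i)]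
    (u : V 0 →ₗ[K] V 3 →ₗ[K] K) (v : V 1 →ₗ[K] V 2 →ₗ[K] K) : MultilinearMap K V K :=
  MultilinearMap.ofIsLinearMap (fun x => u (x 0) (x 3) * v (x 1) (x 2)) fun x i => by
    fin_cases i <;> constructor <;> intros <;> simp [Function.update] <;> ring

theorem LinearMap.exists_apply_apply_ne_zero {W W' : Type*} [AddCommGroup W] [Module K W]
    [AddCommGroup W'] [Module K W'] {u : W →ₗ[K] W' →ₗ[K] K} (hu : u ≠ 0) :
    ∃ x y, u x y ≠ 0 := by
  by_contra! h
  exact hu (LinearMap.ext₂ h)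

theorem tFails_one_one_two_two [CharZero K] (n : Fin 4 → ℕ) (h0 : n 0 = 1) (h1 : n 1 = 1)
    (h2 : n 2 = 2) (h3 : n 3 = 2) : TFails K n 5 fun _ => 0 := by
  refine tFails_of_finrank_lt fun p => Nat.lt_of_le_of_lt (m := 34)
    (finrank_tangentSpan_le_of_generalPosition (fun p hp => ?_) p)
    (by simp [Fin.sum_univ_four, Fin.prod_univ_four, h0, h1, h2, h3])
  obtain ⟨u, hu, hu0⟩ := exists_bilin_ne_zero (K := K) (fun j => p j 0) (fun j => p j 2)
    (by simp [h0, h2])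
  obtain ⟨v, hv, hv0⟩ := exists_bilin_ne_zero (K := K) (fun j => p j 1) (fun j => p j 3)
    (by simp [h1, h3])
  obtain ⟨u', hu', hu0'⟩ := exists_bilin_ne_zero (K := K) (fun j => p j 0) (fun j => p j 3)
    (by simp [h0, h3])
  obtain ⟨v', hv', hv0'⟩ := exists_bilin_ne_zero (K := K) (fun j => p j 1) (fun j => p j 2)
    (by simp [h1, h2])
  let V : Fin 4 → Type _ := fun i => Fin (n i + 1) → K
  have hli : LinearIndependent K
      ![bilinMulBilin (V := V) u v, bilinMulBilin' (V := V) u' v'] := by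
    rw [LinearIndependent.pair_iff]
    intro c c' hc
    have hval : ∀ x0 x1 x2 x3, c * (u x0 x2 * v x1 x3) + c' * (u' x0 x3 * v' x1 x2) = 0 :=
      fun x0 x1 x2 x3 => congrArg (fun F => F fun i => Fin.cases x0 (Fin.cases x1 (Fin.cases x2
        (Fin.cases x3 fun i => i.elim0))) i) hc
    have hc0 : c = 0 := by
      by_contra hc0
      obtain ⟨x1, x3, hx⟩ := v.exists_apply_apply_ne_zero hv
      refine hu (hp.bilin_eq_zero (by omega) hu0 ((-(c' / (c * v x1 x3))) • u'.flip x3)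
        (v' x1) fun x0 x2 => ?_)
      have := hval x0 x1 x2 x3
      simp only [LinearMap.smul_apply, LinearMap.flip_apply, smul_eq_mul]
      field_simp
      linear_combination this
    refine ⟨hc0, ?_⟩
    obtain ⟨x0, x3, hx⟩ := u'.exists_apply_apply_ne_zero hu'
    obtain ⟨x1, x2, hx'⟩ := v'.exists_apply_apply_ne_zero hv'
    have := hval x0 x1 x2 x3
    rw [hc0, zero_mul, zero_add] at this
    exact (mul_eq_zero.1 this).resolve_right (mul_ne_zero hx hx')
  have := finrank_tangentSpan_add_card_le (p := p) hli (by
    intro a j i y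
    fin_cases a
    · change u (Function.update (p j) i y 0) (Function.update (p j) i y 2) *
        v (Function.update (p j) i y 1) (Function.update (p j) i y 3) = 0
      fin_cases i <;> simp [Function.update, hu0, hv0]
    · change u' (Function.update (p j) i y 0) (Function.update (p j) i y 3) *
        v' (Function.update (p j) i y 1) (Function.update (p j) i y 2) = 0
      fin_cases i <;> simp [Function.update, hu0', hv0'])
  simp [Fin.prod_univ_four, h0, h1, h2, h3] at this
  omega

/-- The trilinear form `det (φ x₀, f x₁, g x₂)`. -/
def crossForm {V : Fin 3 → Type*} [∀ i, AddCommGroup (V i)] [∀ i, Module K (V i)]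
    (φ : V 0 →ₗ[K] (Fin 3 → K)) (f : V 1 →ₗ[K] (Fin 3 → K)) (g : V 2 →ₗ[K] (Fin 3 → K)) :
    MultilinearMap K V K :=
  MultilinearMap.ofIsLinearMap (fun x => φ (x 0) ⬝ᵥ (f (x 1) ⨯₃ g (x 2))) fun x i => by
    fin_cases i <;> constructor <;> intros <;> simp [Function.update]

theorem exists_linearIndependent_mem_span {W : Type*} [AddCommGroup W] [Module K W]
    [FiniteDimensional K W] {r m : ℕ} (a : Fin s → Fin (r + 1) → K) (ha : ∀ j, a j ≠ 0)
    (b : Fin s → W) (h : m + s * r ≤ Module.finrank K W * (r + 1)) :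
    ∃ f : Fin m → W →ₗ[K] (Fin (r + 1) → K), LinearIndependent K f ∧
      ∀ e j, ∃ c : K, f e (b j) = c • a j := by
  obtain ⟨f, hf, hf'⟩ := LinearMap.exists_linearIndependent_ker (K := K) (m := m)
    (W := W →ₗ[K] (Fin (r + 1) → K)) (U := ∀ j, (Fin (r + 1) → K) ⧸ (K ∙ a j))
    (LinearMap.pi fun j : Fin s => (K ∙ a j).mkQ ∘ₗ LinearMap.applyₗ (R := K) (b j)) (by
      have : ∀ j, Module.finrank K ((Fin (r + 1) → K) ⧸ (K ∙ a j)) = r := by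
        intro j
        have h1 := (K ∙ a j).finrank_quotient_add_finrank
        rw [finrank_span_singleton (ha j), Module.finrank_fin_fun] at h1
        omega
      simpa [Module.finrank_pi_fintype, Module.finrank_linearMap, this] using h)
  refine ⟨f, hf, fun e j => ?_⟩
  have h1 : (K ∙ a j).mkQ (f e (b j)) = 0 := congrFun (hf' e) j
  rw [Submodule.mkQ_apply, Submodule.Quotient.mk_eq_zero, Submodule.mem_span_singleton] at h1
  obtain ⟨c, hc⟩ := h1
  exact ⟨c, hc.symm⟩

theorem GeneralPosition.linearIndependent_pair {n : Fin k → ℕ}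
    {p : Fin s → ∀ i, Fin (n i + 1) → K} (hp : GeneralPosition p) {i : Fin k} (hn : 1 ≤ n i)
    (hs : n i + 1 ≤ s) {j j' : Fin s} (h : j ≠ j') : LinearIndependent K ![p j i, p j' i] := by
  obtain ⟨t, ht, hcard⟩ := exists_superset_card_eq (s := {j, j'}) (n := n i + 1)
    (by rw [card_pair h]; omega) (by simpa using hs)
  have hsurj : ∀ x ∈ t, ∃ a, t.orderEmbOfFin hcard a = x := by
    intro x hx
    rw [← mem_coe, ← range_orderEmbOfFin t hcard] at hx
    exact hx
  obtain ⟨a, ha⟩ := hsurj j (ht (by simp))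
  obtain ⟨b, hb⟩ := hsurj j' (ht (by simp))
  have hab : a ≠ b := by
    rintro rfl
    exact h (ha.symm.trans hb)
  have hli := (hp i (t.orderEmbOfFin hcard).toEmbedding).comp ![a, b]
    (by
      intro x y hxy
      fin_cases x <;> fin_cases y <;> simp_all)
  convert hli using 1
  ext x
  fin_cases x <;> simp [ha, hb]

theorem tFails_two_three_three [CharZero K] (n : Fin 3 → ℕ) (h0 : n 0 = 2) (h1 : n 1 = 3)
    (h2 : n 2 = 3) : TFails K n 5 fun _ => 0 := by
  refine tFails_of_finrank_lt fun p => Nat.lt_of_le_of_lt (m := 44)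
    (finrank_tangentSpan_le_of_generalPosition (fun p hp => ?_) p)
    (by simp [Fin.sum_univ_three, Fin.prod_univ_three, h0, h1, h2])
  let V : Fin 3 → Type _ := fun i => Fin (n i + 1) → K
  let φ : V 0 ≃ₗ[K] (Fin 3 → K) :=
    LinearEquiv.funCongrLeft K K (finCongr (by rw [h0] : 3 = n 0 + 1))
  have hcross : ∀ i j, i ≠ j → φ (p i 0) ⨯₃ φ (p j 0) ≠ 0 := by
    intro i j hij
    rw [crossProduct_ne_zero_iff_linearIndependent]
    have h := (hp.linearIndependent_pair (by omega) (by omega) hij).map' φ.toLinearMap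
      (LinearEquiv.ker _)
    have heq : φ.toLinearMap ∘ ![p i 0, p j 0] = ![φ (p i 0), φ (p j 0)] := by
      ext x
      fin_cases x <;> rfl
    rwa [heq] at h
  have ha : ∀ j, φ (p j 0) ≠ 0 := by
    intro j hj
    refine hcross j (j + 1) (by simp) ?_
    rw [hj, map_zero, LinearMap.zero_apply]
  obtain ⟨f, hf, hf'⟩ := exists_linearIndependent_mem_span (m := 2) (fun j => φ (p j 0)) ha
    (fun j => p j 1) (by simp [h1])
  obtain ⟨g, hg, hg'⟩ := exists_linearIndependent_mem_span (m := 2) (fun j => φ (p j 0)) ha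
    (fun j => p j 2) (by simp [h2])
  choose κ hκ using hf'
  choose μ hμ using hg'
  have hli : LinearIndependent K fun r : Fin 2 × Fin 2 =>
      crossForm (V := V) φ.toLinearMap (f r.1) (g r.2) := by
    rw [Fintype.linearIndependent_iff] at hf hg ⊢
    intro c hc
    have hval : ∀ y z, ∑ a, ∑ b, c (a, b) • (f a y ⨯₃ g b z) = 0 := by
      intro y z
      refine dotProduct_eq_zero _ fun w => ?_
      have := congrArg (fun F => F fun i => Fin.cases (φ.symm w) (Fin.cases y (Fin.cases z
        fun i => i.elim0)) i) hc
      rw [Fintype.sum_prod_type] at this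
      simp only [_root_.sum_apply, _root_.smul_apply, _root_.zero_apply, smul_eq_mul] at this
      rw [← this]
      simp only [sum_dotProduct, smul_dotProduct, smul_eq_mul]
      refine sum_congr rfl fun a _ => sum_congr rfl fun b _ => ?_
      congr 1
      rw [dotProduct_comm]
      change _ = φ (φ.symm w) ⬝ᵥ _
      rw [φ.apply_symm_apply]
      rfl
    have hoff : ∀ i j, i ≠ j → ∑ a, (∑ b, c (a, b) * μ b j) * κ a i = 0 := by
      intro i j hij
      have := hval (p i 1) (p j 2)
      simp only [hκ, hμ, map_smul, LinearMap.smul_apply, smul_smul, ← sum_smul] at this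
      rw [← (smul_eq_zero.1 this).resolve_right (hcross i j hij)]
      refine sum_congr rfl fun a _ => ?_
      rw [sum_mul]
      exact sum_congr rfl fun b _ => by ring
    have hrow : ∀ j a, ∑ b, c (a, b) * μ b j = 0 := by
      intro j
      refine hf _ ?_
      refine hp.eq_zero_of_forall_mem _ (univ.erase j) (by simp [h1]) fun i hi => ?_
      simp only [LinearMap.sum_apply, LinearMap.smul_apply, hκ, smul_smul, ← sum_smul]
      rw [hoff i j (ne_of_mem_erase hi), zero_smul]
    rintro ⟨a, b⟩
    refine hg (fun b => c (a, b)) ?_ b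
    refine hp.eq_zero_of_forall_mem _ univ (by simp [h2]) fun j _ => ?_
    simp only [LinearMap.sum_apply, LinearMap.smul_apply, hμ, smul_smul, ← sum_smul]
    rw [hrow j a, zero_smul]
  have := finrank_tangentSpan_add_card_le (p := p) hli (by
    rintro ⟨a, b⟩ j i y
    change φ (Function.update (p j) i y 0) ⬝ᵥ
      (f a (Function.update (p j) i y 1) ⨯₃ g b (Function.update (p j) i y 2)) = 0
    fin_cases i <;> simp [Function.update, hκ, hμ])
  simp [Fin.prod_univ_three, h0, h1, h2] at this
  omega

end Exceptional

/-- classification of defective 5-secant varieties.  Let `k ≥ 3` and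
`1 ≤ n₁ ≤ ⋯ ≤ n_k`.  Then `T(n; 5; 0,…,0)` holds unless `(n₁,…,n_k) = (2,3,3)`,
`(1,2,a)` with `a ≥ 5`, `(1,3,a)` with `a ≥ 5`, or `(1,1,2,2)`, and in these
exceptional cases it fails. -/
theorem secant5_classification
    (K : Type*) [Field K] [CharZero K] {k : ℕ} (hk : 3 ≤ k)
    (n : Fin k → ℕ) (hmono : Monotone n) (hpos : ∀ i, 1 ≤ n i) :
    (¬ ((k = 3 ∧ n ⟨0, by omega⟩ = 2 ∧ n ⟨1, by omega⟩ = 3 ∧ n ⟨2, by omega⟩ = 3) ∨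
        (k = 3 ∧ n ⟨0, by omega⟩ = 1 ∧ n ⟨1, by omega⟩ = 2 ∧ 5 ≤ n ⟨2, by omega⟩) ∨
        (k = 3 ∧ n ⟨0, by omega⟩ = 1 ∧ n ⟨1, by omega⟩ = 3 ∧ 5 ≤ n ⟨2, by omega⟩) ∨
        (k = 4 ∧ ∀ i : Fin k, n i = if (i : ℕ) < 2 then 1 else 2)) →
      THolds K n 5 (fun _ => 0)) ∧
    (((k = 3 ∧ n ⟨0, by omega⟩ = 2 ∧ n ⟨1, by omega⟩ = 3 ∧ n ⟨2, by omega⟩ = 3) ∨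
        (k = 3 ∧ n ⟨0, by omega⟩ = 1 ∧ n ⟨1, by omega⟩ = 2 ∧ 5 ≤ n ⟨2, by omega⟩) ∨
        (k = 3 ∧ n ⟨0, by omega⟩ = 1 ∧ n ⟨1, by omega⟩ = 3 ∧ 5 ≤ n ⟨2, by omega⟩) ∨
        (k = 4 ∧ ∀ i : Fin k, n i = if (i : ℕ) < 2 then 1 else 2)) →
      TFails K n 5 (fun _ => 0)) := by
  refine ⟨fun h => ?_, fun h => ?_⟩
  · obtain rfl | rfl | hk5 : k = 3 ∨ k = 4 ∨ 5 ≤ k := by omega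
    · exact tHolds_of_three n hmono hpos (fun h' => h (.inl ⟨rfl, h'⟩))
        (fun h' => h (.inr (.inl ⟨rfl, h'⟩))) (fun h' => h (.inr (.inr (.inl ⟨rfl, h'⟩))))
    · refine tHolds_of_four n hmono hpos fun ⟨h0, h1, h2, h3⟩ =>
        h (.inr (.inr (.inr ⟨rfl, fun i => ?_⟩)))
      fin_cases i <;> simp [h0, h1, h2, h3]
    · exact tHolds_of_five_le hk5 n hpos
  · obtain ⟨rfl, h0, h1, h2⟩ | ⟨rfl, h0, h1, h2⟩ | ⟨rfl, h0, h1, h2⟩ | ⟨rfl, h⟩ := h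
    · exact tFails_two_three_three n h0 h1 h2
    · exact tFails_one_two n h0 h1 h2
    · exact tFails_one_three n h0 h1 h2
    · exact tFails_one_one_two_two n (h 0) (h 1) (h 2) (h 3)
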